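/- Let (X_{ij})_{1≤i≤j≤n} (for each n) be centered jointly Gaussian with unit variances and pairwise correlations uniformly bounded by C·n^{-(1+ε)} for some fixed C > 0, ε > 0, and let X_n be the associated symmetric matrix. Then the largest eigenvalue λ₁(n^{-1/2} X_n) converges to 2 almost surely as n → ∞. -/

import Mathlib

open MeasureTheory ProbabilityTheory Filter Topology

noncomputable section

/-- The largest eigenvalue of a real symmetric matrix, realised as the supremum of its set
of real eigenvalues. -/
def lam1 {n : ℕ} (A : Matrix (Fin n) (Fin n) ℝ) : ℝ :=
  sSup {t : ℝ | ∃ v : Fin n → ℝ, v ≠ 0 ∧ A.mulVec v = t • v}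

/-- A finite family of real random variables is a centered (jointly) Gaussian vector:
every linear combination of the coordinates has a centered Gaussian law. -/
def IsCenteredGaussianVec {Ω : Type*} [MeasureSpace Ω] {ι : Type*} [Fintype ι]
    (X : ι → Ω → ℝ) : Prop :=
  (∀ i, Measurable (X i)) ∧
    ∀ c : ι → ℝ, ∃ v : NNReal,
      Measure.map (fun ω => ∑ i, c i * X i ω) (volume : Measure Ω) = gaussianReal 0 v

/-- Covariance of two real random variables. -/
def pcov {Ω : Type*} [MeasureSpace Ω] (W V : Ω → ℝ) : ℝ :=
  (∫ ω, W ω * V ω) - (∫ ω, W ω) * ∫ ω, V ω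

/-- Variance of a real random variable. -/
def pvar {Ω : Type*} [MeasureSpace Ω] (W : Ω → ℝ) : ℝ := pcov W W

/-- The correlated Gaussian model with parameter `ε` and constant `C`: for each `n`,
`X n` is a random symmetric `n × n` matrix whose entries `(X_{ij})_{i ≤ j}` form a centered
Gaussian vector with unit variances and pairwise correlations bounded by `C * n ^ (-(1+ε))`. -/
structure CorrGaussian (Ω : Type*) [MeasureSpace Ω]
    (X : (n : ℕ) → Ω → Matrix (Fin n) (Fin n) ℝ) (C ε : ℝ) : Prop where
  symm : ∀ n ω, (X n ω).IsSymm
  gauss : ∀ n, IsCenteredGaussianVec fun p : Fin n × Fin n => fun ω => X n ω p.1 p.2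
  var_one : ∀ n, ∀ i j : Fin n, ∫ ω, (X n ω i j) ^ 2 = 1
  corr_le : ∀ n, ∀ i j i' j' : Fin n, ¬((i, j) = (i', j') ∨ (i, j) = (j', i')) →
    |∫ ω, X n ω i j * X n ω i' j'| ≤ C * (n : ℝ) ^ (-(1 + ε))

/-- The all-ones `n × n` matrix `𝟙𝟙ᵀ`. -/
def onesMat (n : ℕ) : Matrix (Fin n) (Fin n) ℝ := Matrix.of fun _ _ => 1

/-- The operator (spectral) norm of a real matrix, i.e. the norm of the induced map on
Euclidean space. -/
def opNorm {n : ℕ} (A : Matrix (Fin n) (Fin n) ℝ) : ℝ :=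
  ‖(Matrix.toEuclideanLin A).toContinuousLinearMap‖

/-- `T n = O_P(a n)`: for every `δ > 0` there are `M > 0` and `n₀` such that
`P(|T n| > M * a n) ≤ δ` for all `n ≥ n₀`. -/
def IsBigOP {Ω : Type*} [MeasureSpace Ω] (T : ℕ → Ω → ℝ) (a : ℕ → ℝ) : Prop :=
  ∀ δ : ℝ, 0 < δ → ∃ M : ℝ, 0 < M ∧ ∃ n₀ : ℕ, ∀ n ≥ n₀,
    (volume {ω | M * a n < |T n ω|}).toReal ≤ δ

/-- The sparse Rademacher(p) law `p δ_{-1} + (1 - 2p) δ_0 + p δ_1`. -/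
def sparseRademacher (p : ℝ) : Measure ℝ :=
  ENNReal.ofReal p • Measure.dirac (-1) + ENNReal.ofReal (1 - 2 * p) • Measure.dirac 0 +
    ENNReal.ofReal p • Measure.dirac 1

end


section PartA
namespace Wig
open MvPolynomial

/-- An abstract Gaussian (Wick) functional on polynomials with covariance `S`. -/
structure IsWick {V : Type*} [Fintype V] (E : MvPolynomial V ℝ →ₗ[ℝ] ℝ) (S : V → V → ℝ) :
    Prop where
  one : E 1 = 1
  ibp : ∀ a p, E (X a * p) = ∑ b, S a b * E (pderiv b p)

/-- Polynomials with nonnegative coefficients. -/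
def NN {V : Type*} (p : MvPolynomial V ℝ) : Prop := ∀ s, 0 ≤ coeff s p

section
variable {V : Type*}

lemma NN.add {p q : MvPolynomial V ℝ} (hp : NN p) (hq : NN q) : NN (p + q) := fun s => by
  rw [coeff_add]; exact add_nonneg (hp s) (hq s)

lemma NN.mul {p q : MvPolynomial V ℝ} (hp : NN p) (hq : NN q) : NN (p * q) := fun s => by
  classical
  rw [coeff_mul]; exact Finset.sum_nonneg fun x _ => mul_nonneg (hp _) (hq _)

lemma NN.zero : NN (0 : MvPolynomial V ℝ) := fun s => by simp

lemma NN.monomial (s : V →₀ ℕ) {c : ℝ} (hc : 0 ≤ c) : NN (monomial s c) := fun t => by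
  classical
  rw [coeff_monomial]; split_ifs <;> simp [hc]

lemma NN.one : NN (1 : MvPolynomial V ℝ) := NN.monomial 0 zero_le_one

lemma NN.X (a : V) : NN (X a : MvPolynomial V ℝ) := NN.monomial _ zero_le_one

lemma NN.sum {ι : Type*} {t : Finset ι} {f : ι → MvPolynomial V ℝ} (h : ∀ i ∈ t, NN (f i)) :
    NN (∑ i ∈ t, f i) := fun s => by
  rw [coeff_sum]; exact Finset.sum_nonneg fun i hi => h i hi s

lemma NN.pderiv {p : MvPolynomial V ℝ} (hp : NN p) (b : V) : NN (pderiv b p) := by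
  have : p = ∑ s ∈ p.support, MvPolynomial.monomial s (coeff s p) := (support_sum_monomial_coeff p).symm
  rw [this, map_sum]
  refine NN.sum fun s _ => ?_
  rw [pderiv_monomial]
  exact NN.monomial _ (mul_nonneg (hp s) (Nat.cast_nonneg _))

lemma NN.induction {P : MvPolynomial V ℝ → Prop} (h0 : P 0) (hadd : ∀ p q, P p → P q → P (p + q))
    (hsmul : ∀ (c : ℝ) p, 0 ≤ c → P p → P (c • p)) (h1 : P 1)
    (hX : ∀ a p, NN p → (∀ b, P (MvPolynomial.pderiv b p)) → P (MvPolynomial.X a * p))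
    {p : MvPolynomial V ℝ} (hp : NN p) : P p := by
  classical
  have key : ∀ d : ℕ, ∀ s : V →₀ ℕ, s.degree = d → P (MvPolynomial.monomial s 1) := by
    intro d
    induction d using Nat.strong_induction_on with
    | _ d ih =>
      intro s hs
      by_cases h : s = 0
      · subst h; exact h1
      · obtain ⟨a, ha⟩ := Finsupp.support_nonempty_iff.mpr h
        have hsa : Finsupp.single a 1 + (s - Finsupp.single a 1) = s := by
          apply add_tsub_cancel_of_le
          rw [Finsupp.single_le_iff]
          exact Nat.one_le_iff_ne_zero.mpr (Finsupp.mem_support_iff.mp ha)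
        set s' := s - Finsupp.single a 1
        have hdeg : s'.degree + 1 = d := by
          rw [← hs, ← hsa, map_add, Finsupp.degree_single]; ring
        have : MvPolynomial.monomial s (1:ℝ) = MvPolynomial.X a * MvPolynomial.monomial s' 1 := by
          rw [MvPolynomial.X, monomial_mul, hsa, one_mul]
        rw [this]
        refine hX a _ (NN.monomial _ zero_le_one) fun b => ?_
        rw [pderiv_monomial, one_mul]
        have e : MvPolynomial.monomial (s' - Finsupp.single b 1) ((s' b : ℕ) : ℝ)
            = ((s' b : ℕ) : ℝ) • MvPolynomial.monomial (s' - Finsupp.single b 1) (1:ℝ) := by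
          rw [smul_monomial, smul_eq_mul, mul_one]
        rw [e]
        refine hsmul _ _ (Nat.cast_nonneg _) (ih (s' - Finsupp.single b 1).degree ?_ _ rfl)
        have : (s' - Finsupp.single b 1).degree ≤ s'.degree :=
          Finsupp.degree_mono tsub_le_self
        omega
  rw [← support_sum_monomial_coeff p]
  refine Finset.sum_induction _ P (fun a b => hadd a b) h0 fun s _ => ?_
  have e : MvPolynomial.monomial s (coeff s p) = coeff s p • MvPolynomial.monomial s (1:ℝ) := by
    rw [smul_monomial, smul_eq_mul, mul_one]
  rw [e]
  exact hsmul _ _ (hp s) (key _ s rfl)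

variable [Fintype V] {E₁ E₂ : MvPolynomial V ℝ →ₗ[ℝ] ℝ} {S₁ S₂ : V → V → ℝ}

lemma IsWick.dom (h1 : IsWick E₁ S₁) (h2 : IsWick E₂ S₂) (hS : ∀ a b, |S₁ a b| ≤ S₂ a b)
    {p : MvPolynomial V ℝ} (hp : NN p) : |E₁ p| ≤ E₂ p := by
  refine NN.induction (P := fun p => |E₁ p| ≤ E₂ p) ?_ ?_ ?_ ?_ ?_ hp
  · simp
  · intro p q hp hq
    rw [map_add, map_add]
    exact (abs_add_le _ _).trans (add_le_add hp hq)
  · intro c p hc hp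
    rw [map_smul, map_smul, smul_eq_mul, smul_eq_mul, abs_mul, abs_of_nonneg hc]
    gcongr
  · simp [h1.one, h2.one]
  · intro a p _ h
    rw [h1.ibp, h2.ibp]
    refine (Finset.abs_sum_le_sum_abs _ _).trans (Finset.sum_le_sum fun b _ => ?_)
    rw [abs_mul]
    exact mul_le_mul (hS a b) (h b) (abs_nonneg _) ((abs_nonneg _).trans (hS a b))

lemma IsWick.nonneg (h2 : IsWick E₂ S₂) (hS : ∀ a b, 0 ≤ S₂ a b)
    {p : MvPolynomial V ℝ} (hp : NN p) : 0 ≤ E₂ p :=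
  (abs_nonneg _).trans (h2.dom h2 (fun a b => (abs_of_nonneg (hS a b)).le) hp)

lemma IsWick.ibp_mul (h : IsWick E₁ S₁) (a : V) (p q : MvPolynomial V ℝ) :
    E₁ (X a * p * q) = ∑ b, S₁ a b * (E₁ (pderiv b p * q) + E₁ (p * pderiv b q)) := by
  rw [mul_assoc, h.ibp]
  refine Finset.sum_congr rfl fun b _ => ?_
  rw [Derivation.leibniz, map_add, smul_eq_mul, smul_eq_mul, mul_comm q, add_comm]

lemma IsWick.dom_cov (h1 : IsWick E₁ S₁) (h2 : IsWick E₂ S₂) (hS : ∀ a b, |S₁ a b| ≤ S₂ a b)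
    {p q : MvPolynomial V ℝ} (hp : NN p) (hq : NN q) :
    |E₁ (p * q) - E₁ p * E₁ q| ≤ E₂ (p * q) - E₂ p * E₂ q := by
  refine NN.induction (P := fun p => |E₁ (p * q) - E₁ p * E₁ q| ≤ E₂ (p * q) - E₂ p * E₂ q)
    ?_ ?_ ?_ ?_ ?_ hp
  · simp
  · intro p p' hp hp'
    have e : ∀ E : MvPolynomial V ℝ →ₗ[ℝ] ℝ, E ((p + p') * q) - E (p + p') * E q
      = (E (p * q) - E p * E q) + (E (p' * q) - E p' * E q) := by
        intro E; rw [add_mul, map_add, map_add]; ring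
    rw [e, e]
    exact (abs_add_le _ _).trans (add_le_add hp hp')
  · intro c p hc hp
    have e : ∀ E : MvPolynomial V ℝ →ₗ[ℝ] ℝ, E ((c • p) * q) - E (c • p) * E q
      = c * (E (p * q) - E p * E q) := by
        intro E; rw [smul_mul_assoc, map_smul, map_smul, smul_eq_mul, smul_eq_mul]; ring
    rw [e, e, abs_mul, abs_of_nonneg hc]
    gcongr
  · simp [h1.one, h2.one]
  · intro a p hp h
    have e : ∀ (E : MvPolynomial V ℝ →ₗ[ℝ] ℝ) (S : V → V → ℝ), IsWick E S →
        E (X a * p * q) - E (X a * p) * E q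
      = ∑ b, S a b * ((E (pderiv b p * q) - E (pderiv b p) * E q) + E (p * pderiv b q)) := by
      intro E S hE
      rw [hE.ibp_mul, hE.ibp, Finset.sum_mul, ← Finset.sum_sub_distrib]
      refine Finset.sum_congr rfl fun b _ => by ring
    rw [e _ _ h1, e _ _ h2]
    refine (Finset.abs_sum_le_sum_abs _ _).trans (Finset.sum_le_sum fun b _ => ?_)
    rw [abs_mul]
    refine mul_le_mul (hS a b) ((abs_add_le _ _).trans (add_le_add (h b) ?_))
      (abs_nonneg _) ((abs_nonneg _).trans (hS a b))
    exact h1.dom h2 hS (hp.mul (hq.pderiv b))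

lemma pderiv_comm' {V : Type*} (a b : V) (p : MvPolynomial V ℝ) :
    pderiv a (pderiv b p) = pderiv b (pderiv a p) := by
  classical
  have : ⁅(pderiv a : Derivation ℝ (MvPolynomial V ℝ) (MvPolynomial V ℝ)),
      (pderiv b : Derivation ℝ (MvPolynomial V ℝ) (MvPolynomial V ℝ))⁆ = 0 := by
    apply MvPolynomial.derivation_ext
    intro i
    simp [Derivation.commutator_apply, pderiv_X, Pi.single_apply, apply_ite]
  have h := DFunLike.congr_fun this p
  simp only [Derivation.commutator_apply, Derivation.zero_apply] at h
  exact sub_eq_zero.mp h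

lemma IsWick.cov_le (h : IsWick E₁ S₁) (hS : ∀ a b, 0 ≤ S₁ a b)
    {p q : MvPolynomial V ℝ} (hp : NN p) (hq : NN q) :
    E₁ (p * q) ≤ E₁ p * E₁ q + ∑ c, ∑ d, S₁ c d * E₁ (pderiv c p * pderiv d q) := by
  refine NN.induction (P := fun p => E₁ (p * q) ≤ E₁ p * E₁ q +
    ∑ c, ∑ d, S₁ c d * E₁ (pderiv c p * pderiv d q)) ?_ ?_ ?_ ?_ ?_ hp
  · simp
  · intro p p' hp hp'
    simp only [add_mul, map_add, mul_add, Finset.sum_add_distrib]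
    linarith
  · intro c p hc hp
    simp only [smul_mul_assoc, map_smul, smul_eq_mul, Derivation.map_smul]
    have := mul_le_mul_of_nonneg_left hp hc
    refine this.trans (le_of_eq ?_)
    rw [mul_add, Finset.mul_sum]
    congr 1
    · ring
    · refine Finset.sum_congr rfl fun x _ => ?_
      rw [Finset.mul_sum]
      exact Finset.sum_congr rfl fun y _ => by ring
  · simp [h.one]
  · intro a p hp ih
    classical
    have hpd : ∀ c, pderiv c (X a * p) = (if c = a then p else 0) + X a * pderiv c p := by
      intro c
      rw [Derivation.leibniz, pderiv_X]
      by_cases hca : c = a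
      · subst hca; simp [add_comm]
      · simp [hca]
    have e1 : ∑ c, ∑ d, S₁ c d * E₁ (pderiv c (X a * p) * pderiv d q)
        = ∑ d, S₁ a d * E₁ (p * pderiv d q)
          + ∑ c, ∑ d, S₁ c d * E₁ (X a * pderiv c p * pderiv d q) := by
      simp only [hpd, add_mul, map_add, mul_add, Finset.sum_add_distrib]
      congr 1
      rw [Finset.sum_eq_single a]
      · simp
      · intro c _ hc; simp [hc]
      · simp
    rw [e1, h.ibp_mul, h.ibp, Finset.sum_mul]
    simp only [mul_add, Finset.sum_add_distrib]
    have e2 : ∑ b, S₁ a b * E₁ (pderiv b p * q) ≤ ∑ b, S₁ a b * E₁ (pderiv b p) * E₁ q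
        + ∑ b, S₁ a b * ∑ c, ∑ d, S₁ c d * E₁ (pderiv c (pderiv b p) * pderiv d q) := by
      rw [← Finset.sum_add_distrib]
      refine Finset.sum_le_sum fun b _ => ?_
      have := mul_le_mul_of_nonneg_left (ih b) (hS a b)
      linarith
    have e3 : ∑ b, S₁ a b * ∑ c, ∑ d, S₁ c d * E₁ (pderiv c (pderiv b p) * pderiv d q)
        ≤ ∑ c, ∑ d, S₁ c d * E₁ (X a * pderiv c p * pderiv d q) := by
      simp only [Finset.mul_sum]
      rw [Finset.sum_comm]
      refine Finset.sum_le_sum fun c _ => ?_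
      rw [Finset.sum_comm]
      refine Finset.sum_le_sum fun d _ => ?_
      rw [h.ibp_mul, Finset.mul_sum]
      refine Finset.sum_le_sum fun b _ => ?_
      rw [pderiv_comm' c b]
      have : 0 ≤ E₁ (pderiv c p * pderiv b (pderiv d q)) :=
        h.nonneg hS ((hp.pderiv c).mul ((hq.pderiv d).pderiv b))
      have h3 : 0 ≤ S₁ c d * (S₁ a b * E₁ (pderiv c p * pderiv b (pderiv d q))) :=
        mul_nonneg (hS c d) (mul_nonneg (hS a b) this)
      nlinarith
    linarith
end
end Wig

end PartA

section PartB
namespace Wig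

lemma memLp_poly_real (f : Polynomial ℝ) (v : NNReal) :
    Integrable (fun x => f.eval x) (gaussianReal 0 v) := by
  induction f using Polynomial.induction_on' with
  | add p q hp hq => simp only [Polynomial.eval_add]; exact hp.add hq
  | monomial n a =>
    have h : Integrable (fun x : ℝ => x ^ n) (gaussianReal 0 v) := by
      have := (memLp_id_gaussianReal (μ := 0) (v := v) n).integrable_norm_pow'
      refine (integrable_norm_iff (by fun_prop)).mp ?_
      simpa using this
    simpa [Polynomial.eval_monomial] using h.const_mul a

lemma stein_real (f : Polynomial ℝ) (v : NNReal) :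
    ∫ x, x * f.eval x ∂(gaussianReal 0 v) = v * ∫ x, f.derivative.eval x ∂(gaussianReal 0 v) := by
  by_cases hv : v = 0
  · subst hv; simp [gaussianReal_zero_var]
  have hintg : ∀ g : Polynomial ℝ, Integrable (fun x => g.eval x * gaussianPDFReal 0 v x) := by
    intro g
    have := memLp_poly_real g v
    rw [gaussianReal_of_var_ne_zero _ hv, integrable_withDensity_iff
      (measurable_gaussianPDF _ _) (ae_of_all _ fun _ => gaussianPDF_lt_top)] at this
    simpa using this
  have hd : ∀ x, HasDerivAt (gaussianPDFReal 0 v) (-(x / v) * gaussianPDFReal 0 v x) x := by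
    intro x
    unfold gaussianPDFReal
    have h1 : HasDerivAt (fun x : ℝ => -(x - 0) ^ 2 / (2 * (v:ℝ))) (-(x / v)) x := by
      have := (((hasDerivAt_id x).sub_const 0).pow 2).neg.div_const (2 * (v:ℝ))
      refine (this.congr_deriv ?_)
      have : (v:ℝ) ≠ 0 := by exact_mod_cast hv
      simp; field_simp
    refine ((h1.exp.const_mul _).congr_deriv ?_)
    ring
  have hv' : (v:ℝ) ≠ 0 := by exact_mod_cast hv
  have key := integral_mul_deriv_eq_deriv_mul_of_integrable (u := fun x => f.eval x)
    (v := gaussianPDFReal 0 v) (u' := fun x => f.derivative.eval x)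
    (v' := fun x => -(x / v) * gaussianPDFReal 0 v x)
    (fun x _ => f.hasDerivAt x) (fun x _ => hd x) ?_ (hintg _) (hintg _)
  · rw [integral_gaussianReal_eq_integral_smul hv, integral_gaussianReal_eq_integral_smul hv]
    have e1 : ∫ x, gaussianPDFReal 0 v x • (x * f.eval x)
        = -v * ∫ x, f.eval x * (-(x / v) * gaussianPDFReal 0 v x) := by
      rw [← integral_const_mul]
      congr 1; ext x; simp only [smul_eq_mul]; field_simp
    rw [e1, key]
    simp only [smul_eq_mul, mul_neg, neg_mul, neg_neg]
    congr 2; ext x; ring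
  · have := (hintg (Polynomial.X * f)).const_mul (-(1/(v:ℝ)))
    refine this.congr (ae_of_all _ fun x => ?_)
    simp only [Polynomial.eval_mul, Polynomial.eval_X, Pi.mul_apply]
    ring

lemma deriv_aeval_line {V : Type*} [Fintype V] (u s : V → ℝ) (p : MvPolynomial V ℝ) :
    (MvPolynomial.aeval (fun b => Polynomial.C (u b) + Polynomial.C (s b) * Polynomial.X) p
      : Polynomial ℝ).derivative
    = ∑ b, Polynomial.C (s b) *
      MvPolynomial.aeval (fun b => Polynomial.C (u b) + Polynomial.C (s b) * Polynomial.X)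
        (MvPolynomial.pderiv b p) := by
  classical
  induction p using MvPolynomial.induction_on with
  | C a => simp [MvPolynomial.algebraMap_eq]
  | add p q hp hq => simp [hp, hq, mul_add, Finset.sum_add_distrib]
  | mul_X p i hp =>
    rw [map_mul, Polynomial.derivative_mul, hp, MvPolynomial.aeval_X]
    have hd : (Polynomial.C (u i) + Polynomial.C (s i) * Polynomial.X).derivative
        = Polynomial.C (s i) := by simp
    rw [hd]
    simp only [Derivation.leibniz, map_add, smul_eq_mul, MvPolynomial.pderiv_X, map_mul,
      MvPolynomial.aeval_X]
    generalize hφ : (MvPolynomial.aeval (R := ℝ) fun b => Polynomial.C (u b) +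
          Polynomial.C (s b) * Polynomial.X) = φ
    have : ∀ x : V, Polynomial.C (s x) * (φ p * φ (Pi.single (M := fun _ => MvPolynomial V ℝ) x 1 i))
          = if x = i then Polynomial.C (s i) * φ p else 0 := by
      intro x
      by_cases hx : x = i
      · subst hx; simp
      · rw [Pi.single_eq_of_ne (Ne.symm hx)]; simp [hx]
    conv_rhs => enter [2, x]; rw [mul_add, this]
    rw [Finset.sum_add_distrib, Finset.sum_ite_eq' , if_pos (Finset.mem_univ _), Finset.sum_mul,
      add_comm, mul_comm (φ p)]
    congr 1
    exact Finset.sum_congr rfl fun b _ => by ring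

lemma eval_line {V : Type*} (u s : V → ℝ) (p : MvPolynomial V ℝ) (x : ℝ) :
    (MvPolynomial.aeval (fun b => Polynomial.C (u b) + Polynomial.C (s b) * Polynomial.X) p
      : Polynomial ℝ).eval x = MvPolynomial.eval (fun b => u b + s b * x) p := by
  induction p using MvPolynomial.induction_on with
  | C a => simp [MvPolynomial.algebraMap_eq]
  | add p q hp hq => simp [hp, hq]
  | mul_X p i hp => simp [hp]

variable {Ω : Type*} [MeasurableSpace Ω] {μ : Measure Ω} {V : Type*} [Fintype V]

lemma memLp_poly {X : V → Ω → ℝ} (h : ∀ i, ∀ r : ℕ, MemLp (X i) r μ) [IsProbabilityMeasure μ]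
    (p : MvPolynomial V ℝ) :
    ∀ r : ℕ, MemLp (fun ω => MvPolynomial.eval (fun i => X i ω) p) r μ := by
  induction p using MvPolynomial.induction_on with
  | C a => intro r; simpa using memLp_const a
  | add p q hp hq => intro r; simp only [map_add]; exact (hp r).add (hq r)
  | mul_X p i hp =>
    intro r
    have : ENNReal.HolderTriple ((2 * r : ℕ) : ENNReal) ((2 * r : ℕ) : ENNReal) (r : ENNReal) := by
      constructor
      push_cast
      rcases Nat.eq_zero_or_pos r with h0 | h0
      · subst h0; simp
      · rw [ENNReal.mul_inv (by simp) (by simp), ← add_mul, ENNReal.inv_two_add_inv_two, one_mul]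
    simp only [map_mul, MvPolynomial.eval_X]
    exact MemLp.mul (r := (r : ENNReal)) (h i (2 * r)) (hp (2 * r))

theorem exists_isWick [IsProbabilityMeasure μ] {X : V → Ω → ℝ} (hm : ∀ i, Measurable (X i))
    (hG : HasGaussianLaw (fun ω i => X i ω) μ) (h0 : ∀ i, ∫ ω, X i ω ∂μ = 0) :
    ∃ E : MvPolynomial V ℝ →ₗ[ℝ] ℝ, IsWick E (fun a b => ∫ ω, X a ω * X b ω ∂μ) ∧
      (∀ p, E p = ∫ ω, MvPolynomial.eval (fun i => X i ω) p ∂μ) ∧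
      ∀ p, Integrable (fun ω => MvPolynomial.eval (fun i => X i ω) p) μ := by
  classical
  have hL : ∀ i, ∀ r : ℕ, MemLp (X i) r μ := fun i r => (hG.eval i).memLp (by simp)
  have hI : ∀ p, Integrable (fun ω => MvPolynomial.eval (fun i => X i ω) p) μ := fun p => by
    have := memLp_poly hL p 1
    exact memLp_one_iff_integrable.mp (by simpa using this)
  have hI2 : ∀ a b, Integrable (fun ω => X a ω * X b ω) μ := fun a b => by
    have := hI (MvPolynomial.X a * MvPolynomial.X b)
    simpa only [map_mul, MvPolynomial.eval_X] using this
  refine ⟨{ toFun := fun p => ∫ ω, MvPolynomial.eval (fun i => X i ω) p ∂μ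
            map_add' := fun p q => ?_, map_smul' := fun c p => ?_ }, ⟨?_, ?_⟩, fun p => rfl, hI⟩
  · simp only [map_add]; exact integral_add (hI p) (hI q)
  · simp [MvPolynomial.smul_eval, integral_const_mul]
  · simp
  intro a p
  simp only [LinearMap.coe_mk, AddHom.coe_mk, map_mul, MvPolynomial.eval_X]
  by_cases hs : ∫ ω, X a ω * X a ω ∂μ = 0
  · have hz : X a =ᵐ[μ] 0 := by
      rw [integral_eq_zero_iff_of_nonneg (fun ω => mul_self_nonneg _) (hI2 a a)] at hs
      filter_upwards [hs] with ω h
      simpa using h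
    have e1 : ∀ f : Ω → ℝ, ∫ ω, X a ω * f ω ∂μ = 0 := fun f => by
      rw [← integral_zero Ω ℝ (μ := μ)]
      apply integral_congr_ae
      filter_upwards [hz] with ω h
      simp [h]
    simp [e1]
  set σ := ∫ ω, X a ω * X a ω ∂μ with hσ
  set s : V → ℝ := fun b => (∫ ω, X a ω * X b ω ∂μ) / σ with hsdef
  let U : V → Ω → ℝ := fun b ω => X b ω - s b * X a ω
  have hUm : ∀ b, Measurable (U b) := fun b => (hm b).sub ((hm a).const_mul _)
  -- joint law
  let L : (V → ℝ) →ₗ[ℝ] ((Unit → ℝ) × (V → ℝ)) :=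
    { toFun := fun x => (fun _ => x a, fun b => x b - s b * x a)
      map_add' := fun x y => by ext <;> simp; ring
      map_smul' := fun c x => by ext <;> simp; ring }
  have hJ : HasGaussianLaw (fun ω => ((fun i : Unit => X a ω), fun b => U b ω)) μ :=
    hG.map (LinearMap.toContinuousLinearMap L)
  have hind : IndepFun (fun ω (_ : Unit) => X a ω) (fun ω b => U b ω) μ := by
    refine HasGaussianLaw.indepFun_of_covariance_eval (X := fun _ => X a) hJ fun _ b => ?_
    rw [covariance_eq_sub]
    · simp only [h0 a, zero_mul, sub_zero, Pi.mul_apply]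
      have : ∀ ω, X a ω * U b ω = X a ω * X b ω - s b * (X a ω * X a ω) := fun ω => by
        simp only [U]; ring
      simp_rw [this]
      rw [integral_sub (hI2 a b) ((hI2 a a).const_mul _), integral_const_mul, ← hσ, hsdef]
      field_simp; ring
    · simpa using hL a 2
    · have := (hL b 2).sub ((hL a 2).const_mul (s b))
      exact_mod_cast this
  have hind' : IndepFun (X a) (fun ω b => U b ω) μ :=
    hind.comp (φ := fun f : Unit → ℝ => f ()) (measurable_pi_apply _) measurable_id
  have hlaw : μ.map (X a) = gaussianReal 0 σ.toNNReal := by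
    rw [(hG.eval a).map_eq_gaussianReal, h0 a, variance_of_integral_eq_zero (hm a).aemeasurable (h0 a)]
    simp [hσ, sq]
  have hσ0 : 0 ≤ σ := integral_nonneg fun ω => mul_self_nonneg _
  have hprod : μ.map (fun ω => (X a ω, fun b => U b ω))
      = (gaussianReal 0 σ.toNNReal).prod (μ.map (fun ω b => U b ω)) := by
    rw [← hlaw]
    exact (indepFun_iff_map_prod_eq_prod_map_map (hm a).aemeasurable
      (measurable_pi_lambda _ hUm).aemeasurable).mp hind'
  have hXU : ∀ ω, (fun i => X i ω) = fun b => U b ω + s b * X a ω := fun ω => by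
    ext b; simp [U]
  have hpm : Measurable (fun ω => (X a ω, fun b => U b ω)) :=
    (hm a).prodMk (measurable_pi_lambda _ hUm)
  have hUm' : Measurable (fun ω b => U b ω) := measurable_pi_lambda _ hUm
  have : IsProbabilityMeasure (μ.map (fun ω b => U b ω)) :=
    Measure.isProbabilityMeasure_map hUm'.aemeasurable
  have hcont : ∀ q : MvPolynomial V ℝ, Continuous
      (fun z : ℝ × (V → ℝ) => MvPolynomial.eval (fun b => z.2 b + s b * z.1) q) := fun q =>
    (MvPolynomial.continuous_eval q).comp (by fun_prop)
  -- Fubini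
  have hfub : ∀ F : ℝ × (V → ℝ) → ℝ, Continuous F →
      Integrable (fun ω => F (X a ω, fun b => U b ω)) μ →
      ∫ ω, F (X a ω, fun b => U b ω) ∂μ =
      ∫ u, ∫ x, F (x, u) ∂(gaussianReal 0 σ.toNNReal) ∂(μ.map (fun ω b => U b ω)) := by
    intro F hF hFi
    have hFi' := (integrable_map_measure (f := fun ω => (X a ω, fun b => U b ω)) (g := F) (μ := μ)
      hF.aestronglyMeasurable hpm.aemeasurable).mpr hFi
    rw [hprod] at hFi'
    rw [← integral_prod_symm _ hFi', ← hprod, integral_map hpm.aemeasurable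
      hF.aestronglyMeasurable]
  have hstep : ∀ q : MvPolynomial V ℝ, ∫ ω, MvPolynomial.eval (fun i => X i ω) q ∂μ =
      ∫ u, ∫ x, MvPolynomial.eval (fun b => u b + s b * x) q ∂(gaussianReal 0 σ.toNNReal)
        ∂(μ.map (fun ω b => U b ω)) := by
    intro q
    have := hfub (fun z => MvPolynomial.eval (fun b => z.2 b + s b * z.1) q) (hcont q)
      (by simpa only [hXU] using hI q)
    simpa only [hXU] using this
  have hlhs : ∫ ω, X a ω * MvPolynomial.eval (fun i => X i ω) p ∂μ =
      ∫ u, ∫ x, x * MvPolynomial.eval (fun b => u b + s b * x) p ∂(gaussianReal 0 σ.toNNReal)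
        ∂(μ.map (fun ω b => U b ω)) := by
    have hi := hI (MvPolynomial.X a * p)
    simp only [map_mul, MvPolynomial.eval_X] at hi
    have := hfub (fun z => z.1 * MvPolynomial.eval (fun b => z.2 b + s b * z.1) p)
      (continuous_fst.mul (hcont p)) (by simpa only [← hXU] using hi)
    simpa only [← hXU] using this
  -- inner Stein
  have hin : ∀ u : V → ℝ, ∫ x, x * MvPolynomial.eval (fun b => u b + s b * x) p
      ∂(gaussianReal 0 σ.toNNReal) = ∫ x, MvPolynomial.eval (fun b => u b + s b * x)
        (∑ b, (∫ ω, X a ω * X b ω ∂μ) • MvPolynomial.pderiv b p) ∂(gaussianReal 0 σ.toNNReal) := by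
    intro u
    have := stein_real (MvPolynomial.aeval
      (fun b => Polynomial.C (u b) + Polynomial.C (s b) * Polynomial.X) p) σ.toNNReal
    simp only [eval_line] at this
    rw [this, ← integral_const_mul]
    congr 1; ext x
    rw [deriv_aeval_line, Polynomial.eval_finsetSum, map_sum, Finset.mul_sum,
      Real.coe_toNNReal _ hσ0]
    refine Finset.sum_congr rfl fun b _ => ?_
    rw [Polynomial.eval_mul, Polynomial.eval_C, eval_line, MvPolynomial.smul_eval, ← mul_assoc]
    congr 1
    rw [hsdef]; field_simp
  rw [hlhs]
  simp_rw [hin]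
  rw [← hstep]
  simp only [map_sum, MvPolynomial.smul_eval]
  rw [integral_finsetSum _ fun b _ => (hI _).const_mul _]
  simp_rw [integral_const_mul]

end Wig

end PartB

section PartC
namespace Wig
open MvPolynomial

/-- The generic matrix of variables. -/
noncomputable def gen (n : ℕ) : Matrix (Fin n) (Fin n) (MvPolynomial (Fin n × Fin n) ℝ) :=
  Matrix.of fun i j => X (i, j)

/-- Trace of powers of the generic matrix. -/
noncomputable def trp (n k : ℕ) : MvPolynomial (Fin n × Fin n) ℝ := (gen n ^ k).trace

/-- Evaluation at a matrix. -/
noncomputable def ev {n : ℕ} (A : Matrix (Fin n) (Fin n) ℝ) :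
    MvPolynomial (Fin n × Fin n) ℝ →+* ℝ := eval fun v => A v.1 v.2

lemma ev_gen_pow {n : ℕ} (A : Matrix (Fin n) (Fin n) ℝ) (k : ℕ) (i j : Fin n) :
    ev A ((gen n ^ k) i j) = (A ^ k) i j := by
  have h : (ev A).mapMatrix (gen n) = A := by
    ext i j; simp [gen, ev]
  have : (ev A).mapMatrix (gen n ^ k) = A ^ k := by rw [map_pow, h]
  rw [← this]; rfl

lemma ev_trp {n : ℕ} (A : Matrix (Fin n) (Fin n) ℝ) (k : ℕ) :
    ev A (trp n k) = (A ^ k).trace := by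
  simp [trp, Matrix.trace, ev_gen_pow]

lemma NN_gen_pow (n k : ℕ) (i j : Fin n) : NN ((gen n ^ k) i j) := by
  induction k generalizing i j with
  | zero =>
    rw [pow_zero, Matrix.one_apply]
    split_ifs
    · exact NN.one
    · exact NN.zero
  | succ k ih =>
    rw [pow_succ, Matrix.mul_apply]
    exact NN.sum fun t _ => (ih i t).mul (NN.X _)

lemma NN_trp (n k : ℕ) : NN (trp n k) := NN.sum fun i _ => NN_gen_pow n k i i

lemma pderiv_gen_pow (n m : ℕ) (i j : Fin n) (b : Fin n × Fin n) :
    pderiv b ((gen n ^ m) i j) =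
      ∑ r ∈ Finset.range m, (gen n ^ r) i b.1 * (gen n ^ (m - 1 - r)) b.2 j := by
  classical
  induction m generalizing i j with
  | zero =>
    rw [pow_zero, Matrix.one_apply]
    split_ifs <;> simp
  | succ m ih =>
    rw [pow_succ, Matrix.mul_apply, map_sum]
    have h1 : ∀ t, pderiv b ((gen n ^ m) i t * gen n t j) =
        (∑ r ∈ Finset.range m, (gen n ^ r) i b.1 * ((gen n ^ (m - 1 - r)) b.2 t * gen n t j))
        + (if t = b.1 then (gen n ^ m) i b.1 * (1 : Matrix (Fin n) (Fin n) _) b.2 j else 0) := by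
      intro t
      rw [Derivation.leibniz, ih, smul_eq_mul, smul_eq_mul, add_comm, mul_comm, Finset.sum_mul]
      congr 1
      · exact Finset.sum_congr rfl fun r _ => by ring
      · simp only [gen, Matrix.of_apply, pderiv_X]
        by_cases ht : t = b.1
        · subst ht
          by_cases hj : j = b.2
          · subst hj; simp
          · have : (b.1, j) ≠ b := fun h => hj (congrArg Prod.snd h)
            rw [Pi.single_eq_of_ne this]
            simp [Matrix.one_apply, Ne.symm hj]
        · have : (t, j) ≠ b := fun h => ht (congrArg Prod.fst h)
          rw [Pi.single_eq_of_ne this]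
          simp [ht]
    simp only [h1]
    rw [Finset.sum_add_distrib, Finset.sum_comm, Finset.sum_ite_eq', if_pos (Finset.mem_univ _),
      Finset.sum_range_succ]
    congr 1
    · refine Finset.sum_congr rfl fun r hr => ?_
      rw [← Finset.mul_sum, ← Matrix.mul_apply, ← pow_succ]
      have := Finset.mem_range.mp hr
      have e : m - 1 - r + 1 = m + 1 - 1 - r := by omega
      rw [e]
    · simp

lemma pderiv_trp (n m : ℕ) (b : Fin n × Fin n) :
    pderiv b (trp n m) = (m : ℝ) • (gen n ^ (m - 1)) b.2 b.1 := by
  rw [trp, Matrix.trace, map_sum]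
  simp only [Matrix.diag_apply, pderiv_gen_pow]
  rw [Finset.sum_comm]
  have : ∀ r ∈ Finset.range m, ∑ i, (gen n ^ r) i b.1 * (gen n ^ (m - 1 - r)) b.2 i
      = (gen n ^ (m - 1)) b.2 b.1 := by
    intro r hr
    have := Finset.mem_range.mp hr
    have h2 : m - 1 = (m - 1 - r) + r := by omega
    conv_rhs => rw [h2, pow_add, Matrix.mul_apply]
    exact Finset.sum_congr rfl fun i _ => mul_comm _ _
  rw [Finset.sum_congr rfl this]
  simp [Nat.cast_smul_eq_nsmul]

variable {n : ℕ} {E EA EY : MvPolynomial (Fin n × Fin n) ℝ →ₗ[ℝ] ℝ}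
  {S SA : Fin n × Fin n → Fin n × Fin n → ℝ}

lemma IsWick.trp_succ (hE : IsWick E S) (m : ℕ) :
    E (trp n (m + 1)) = ∑ r ∈ Finset.range m, ∑ a, ∑ b, S a b *
      E ((gen n ^ r) a.2 b.1 * (gen n ^ (m - 1 - r)) b.2 a.1) := by
  have h1 : trp n (m + 1) = ∑ a : Fin n × Fin n, X a * (gen n ^ m) a.2 a.1 := by
    rw [trp, pow_succ', Matrix.trace, Fintype.sum_prod_type]
    simp [Matrix.mul_apply, gen]
  rw [h1, map_sum, Finset.sum_comm]
  refine Finset.sum_congr rfl fun a _ => ?_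
  rw [hE.ibp, Finset.sum_comm]
  refine Finset.sum_congr rfl fun b _ => ?_
  rw [pderiv_gen_pow, map_sum, Finset.mul_sum]

/-- positivity of a functional with respect to evaluation at symmetric matrices. -/
def SymPos (E : MvPolynomial (Fin n × Fin n) ℝ →ₗ[ℝ] ℝ) : Prop :=
  ∀ p q, (∀ A : Matrix (Fin n) (Fin n) ℝ, A.IsSymm → ev A p ≤ ev A q) → E p ≤ E q

lemma SymPos.congr (h : SymPos E) {p q : MvPolynomial (Fin n × Fin n) ℝ}
    (hpq : ∀ A : Matrix (Fin n) (Fin n) ℝ, A.IsSymm → ev A p = ev A q) : E p = E q :=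
  le_antisymm (h p q fun A hA => (hpq A hA).le) (h q p fun A hA => (hpq A hA).ge)

/-- Covariance of the GOE-type entries. -/
noncomputable def SG (n : ℕ) (a b : Fin n × Fin n) : ℝ :=
  (1 / (n:ℝ)) * ((if b = a then 1 else 0) + (if b = a.swap then 1 else 0))

/-- Covariance of the dominating model. -/
noncomputable def SY (n : ℕ) (δ : ℝ) (a b : Fin n × Fin n) : ℝ :=
  (1 / (n:ℝ)) * ((if b = a then 1 else 0) + (if b = a.swap then 1 else 0) + δ)

/-- Sum of all entries of a power of the generic matrix. -/
noncomputable def tot (n k : ℕ) : MvPolynomial (Fin n × Fin n) ℝ :=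
  ∑ b : Fin n × Fin n, (gen n ^ k) b.1 b.2

lemma symm_pow {A : Matrix (Fin n) (Fin n) ℝ} (hA : A.IsSymm) (k : ℕ) (i j : Fin n) :
    (A ^ k) i j = (A ^ k) j i := by
  have : (A ^ k).IsSymm := hA.pow k
  exact (this.apply i j).symm

lemma tr_mul_symm {A : Matrix (Fin n) (Fin n) ℝ} (hA : A.IsSymm) (r s : ℕ) :
    ∑ a : Fin n × Fin n, (A ^ r) a.2 a.1 * (A ^ s) a.2 a.1 = (A ^ (r + s)).trace := by
  rw [pow_add, Matrix.trace, Fintype.sum_prod_type]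
  simp only [Matrix.diag_apply, Matrix.mul_apply]
  exact Finset.sum_congr rfl fun i _ => Finset.sum_congr rfl fun j _ => by
    rw [symm_pow hA r]

lemma tot_sq_le {A : Matrix (Fin n) (Fin n) ℝ} (hA : A.IsSymm) (r : ℕ) :
    (ev A (tot n r)) ^ 2 ≤ (n:ℝ) ^ 2 * (A ^ (2 * r)).trace := by
  rw [two_mul, ← tr_mul_symm hA r r, tot, map_sum]
  simp only [ev_gen_pow]
  have := sq_sum_le_card_mul_sum_sq (s := (Finset.univ : Finset (Fin n × Fin n)))
    (f := fun b => (A ^ r) b.1 b.2)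
  refine this.trans (le_of_eq ?_)
  simp only [Finset.card_univ, Fintype.card_prod, Fintype.card_fin]
  push_cast
  rw [sq (n:ℝ)]
  congr 1
  exact Finset.sum_congr rfl fun b _ => by rw [symm_pow hA r, sq]

lemma tr_mul_le {A : Matrix (Fin n) (Fin n) ℝ} (hA : A.IsSymm) (r s : ℕ) :
    ∑ a : Fin n × Fin n, (A ^ r) a.2 a.1 * (A ^ s) a.2 a.1 ≤
      ((A ^ (2 * r)).trace + (A ^ (2 * s)).trace) / 2 := by
  rw [two_mul, two_mul, ← tr_mul_symm hA r r, ← tr_mul_symm hA s s, ← Finset.sum_add_distrib,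
    Finset.sum_div]
  exact Finset.sum_le_sum fun a _ => by nlinarith [sq_nonneg ((A ^ r) a.2 a.1 - (A ^ s) a.2 a.1)]

lemma tot_mul_le {A : Matrix (Fin n) (Fin n) ℝ} (hA : A.IsSymm) (r s : ℕ) :
    ev A (tot n r) * ev A (tot n s) ≤
      (n:ℝ) ^ 2 * (((A ^ (2 * r)).trace + (A ^ (2 * s)).trace) / 2) := by
  nlinarith [sq_nonneg (ev A (tot n r) - ev A (tot n s)), tot_sq_le hA r, tot_sq_le hA s]

lemma tot_eq_swap (n k : ℕ) : tot n k = ∑ b : Fin n × Fin n, (gen n ^ k) b.2 b.1 := by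
  rw [tot]; exact (Equiv.prodComm _ _).sum_comp (fun b : Fin n × Fin n => (gen n ^ k) b.2 b.1)

lemma sum_sum_tot (n r s : ℕ) : ∑ a : Fin n × Fin n, ∑ b : Fin n × Fin n,
      (gen n ^ r) a.2 b.1 * (gen n ^ s) b.2 a.1 = tot n r * tot n s := by
  simp only [tot, Fintype.sum_prod_type, Finset.sum_mul_sum]
  calc _ = ∑ j, ∑ k, ∑ l, ∑ i, (gen n ^ r) j k * (gen n ^ s) l i := by
        rw [Finset.sum_comm]
        refine Finset.sum_congr rfl fun j _ => ?_
        rw [Finset.sum_comm]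
        refine Finset.sum_congr rfl fun k _ => ?_
        rw [Finset.sum_comm]
    _ = _ := by
        refine Finset.sum_congr rfl fun j _ => ?_
        rw [Finset.sum_comm]

/-- contraction identity for the sums in the trace recursion. -/
lemma E_swap (E : MvPolynomial (Fin n × Fin n) ℝ →ₗ[ℝ] ℝ) (r s : ℕ) :
    ∑ a : Fin n × Fin n, ∑ b : Fin n × Fin n, (if b = a.swap then (1:ℝ) else 0) *
      E ((gen n ^ r) a.2 b.1 * (gen n ^ s) b.2 a.1) = E (trp n r * trp n s) := by
  simp only [ite_mul, one_mul, zero_mul, Finset.sum_ite_eq', Finset.sum_ite_eq,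
    Finset.mem_univ, if_true, Prod.fst_swap, Prod.snd_swap]
  rw [← map_sum, trp, trp, Matrix.trace, Matrix.trace, Finset.sum_mul_sum,
    Fintype.sum_prod_type, Finset.sum_comm]
  rfl

lemma E_diag (E : MvPolynomial (Fin n × Fin n) ℝ →ₗ[ℝ] ℝ) (r s : ℕ) :
    ∑ a : Fin n × Fin n, ∑ b : Fin n × Fin n, (if b = a then (1:ℝ) else 0) *
      E ((gen n ^ r) a.2 b.1 * (gen n ^ s) b.2 a.1)
      = E (∑ a : Fin n × Fin n, (gen n ^ r) a.2 a.1 * (gen n ^ s) a.2 a.1) := by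
  simp only [ite_mul, one_mul, zero_mul, Finset.sum_ite_eq', Finset.sum_ite_eq,
    Finset.mem_univ, if_true]
  rw [← map_sum]

/-- The sequence of moments of the semicircle law. -/
def cs : ℕ → ℝ
  | 0 => 1
  | 1 => 0
  | (k + 2) => ∑ r : Fin (k + 1), cs r.1 * cs (k - r.1)
decreasing_by all_goals omega

end Wig

end PartC

section PartD
namespace Wig
open MvPolynomial

lemma cs_zero : cs 0 = 1 := by rw [cs]
lemma cs_one : cs 1 = 0 := by rw [cs]
lemma cs_add_two (k : ℕ) : cs (k + 2) = ∑ r ∈ Finset.range (k + 1), cs r * cs (k - r) := by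
  rw [cs, Finset.sum_range (fun r => cs r * cs (k - r))]

lemma sum_even (g : ℕ → ℝ) (hg : ∀ i, g (2 * i + 1) = 0) (j : ℕ) :
    ∑ r ∈ Finset.range (2 * j + 1), g r = ∑ i ∈ Finset.range (j + 1), g (2 * i) := by
  induction j with
  | zero => simp
  | succ j ih =>
    rw [show 2 * (j + 1) + 1 = (2 * j + 1) + 1 + 1 by ring, Finset.sum_range_succ,
      Finset.sum_range_succ, ih, hg, Finset.sum_range_succ (n := j + 1)]
    rw [add_zero]
    rfl

lemma cs_even_odd (j : ℕ) : cs (2 * j) = catalan j ∧ cs (2 * j + 1) = 0 := by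
  induction j using Nat.strong_induction_on with
  | _ j ih =>
    match j with
    | 0 => simp [cs_zero, cs_one]
    | j + 1 =>
      have hodd : ∀ i, i ≤ j → cs (2 * i + 1) = 0 := fun i hi => (ih i (by omega)).2
      have hev : ∀ i, i ≤ j → cs (2 * i) = catalan i := fun i hi => (ih i (by omega)).1
      constructor
      · rw [show 2 * (j + 1) = 2 * j + 2 by ring, cs_add_two, 
          catalan_succ, ← Finset.sum_range (fun r => catalan r * catalan (j - r))]
        push_cast
        have := sum_even (fun r => if r ≤ 2 * j then cs r * cs (2 * j - r) else 0)
          (fun i => by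
            split_ifs with h
            · rw [hodd i (by omega), zero_mul]
            · rfl) j
        rw [Finset.sum_congr rfl (g := fun r => if r ≤ 2 * j then cs r * cs (2 * j - r) else 0)
          (fun r hr => by rw [if_pos (by have := Finset.mem_range.mp hr; omega)]), this]
        refine Finset.sum_congr rfl fun i hi => ?_
        have := Finset.mem_range.mp hi
        rw [if_pos (by omega), show 2 * j - 2 * i = 2 * (j - i) by omega, hev _ (by omega),
          hev _ (by omega)]
      · rw [show 2 * (j + 1) + 1 = (2 * j + 1) + 2 by ring, cs_add_two]
        refine Finset.sum_eq_zero fun r hr => ?_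
        have := Finset.mem_range.mp hr
        rcases Nat.even_or_odd' r with ⟨i, rfl | rfl⟩
        · rw [show 2 * j + 1 - 2 * i = 2 * (j - i) + 1 by omega, hodd _ (by omega), mul_zero]
        · rw [hodd _ (by omega), zero_mul]

lemma cs_nonneg (k : ℕ) : 0 ≤ cs k := by
  rcases Nat.even_or_odd' k with ⟨i, rfl | rfl⟩
  · rw [(cs_even_odd i).1]; positivity
  · rw [(cs_even_odd i).2]

lemma cs_mono2 (k : ℕ) : cs k ≤ cs (k + 2) := by
  rw [cs_add_two, Finset.sum_range_succ']
  simp only [cs_zero, one_mul, Nat.sub_zero]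
  have : 0 ≤ ∑ r ∈ Finset.range k, cs (r + 1) * cs (k - (r + 1)) :=
    Finset.sum_nonneg fun r _ => mul_nonneg (cs_nonneg _) (cs_nonneg _)
  linarith

lemma cs_le (k : ℕ) : cs k ≤ 2 ^ k := by
  rcases Nat.even_or_odd' k with ⟨i, rfl | rfl⟩
  · rw [(cs_even_odd i).1, catalan_eq_centralBinom_div]
    have h1 : i.centralBinom / (i + 1) ≤ 4 ^ i := by
      refine (Nat.div_le_self _ _).trans ?_
      have := Nat.choose_le_two_pow (2 * i) i
      rw [pow_mul] at this
      simpa [Nat.centralBinom] using this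
    have : ((i.centralBinom / (i + 1) : ℕ) : ℝ) ≤ 4 ^ i := by exact_mod_cast h1
    rw [pow_mul]; norm_num at this ⊢; exact this
  · rw [(cs_even_odd i).2]; positivity

/-- polynomial lower bound on the even semicircle moments. -/
lemma cs_ge (i : ℕ) : (4:ℝ) ^ i ≤ 2 * (i + 1) ^ 2 * cs (2 * i) := by
  rw [(cs_even_odd i).1]
  rcases Nat.eq_zero_or_pos i with rfl | hi
  · norm_num
  have h1 := Nat.four_pow_le_two_mul_self_mul_centralBinom i hi
  have h2 := succ_mul_catalan_eq_centralBinom i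
  have h3 : 4 ^ i ≤ 2 * i * ((i + 1) * catalan i) := by rw [h2]; exact h1
  have h4 : (4:ℝ) ^ i ≤ 2 * i * ((i + 1) * catalan i) := by exact_mod_cast h3
  refine h4.trans ?_
  have : (0:ℝ) ≤ catalan i := by positivity
  nlinarith [mul_nonneg (by positivity : (0:ℝ) ≤ i + 1) this]

variable {n : ℕ} {E EA EY : MvPolynomial (Fin n × Fin n) ℝ →ₗ[ℝ] ℝ}

lemma SY_nonneg {δ : ℝ} (hδ : 0 ≤ δ) (a b : Fin n × Fin n) : 0 ≤ SY n δ a b := by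
  unfold SY; positivity

lemma trp_nonneg {δ : ℝ} (hδ : 0 ≤ δ) (hE : IsWick E (SY n δ)) (k : ℕ) : 0 ≤ E (trp n k) :=
  hE.nonneg (SY_nonneg hδ) (NN_trp n k)

lemma trp_zero_eq (n : ℕ) : trp n 0 = C (n:ℝ) := by simp [trp]

lemma E_trp_zero {S} (hE : IsWick E S) : E (trp n 0) = n := by
  rw [trp_zero_eq, ← mul_one (C (n:ℝ)), ← smul_eq_C_mul, map_smul, hE.one]; simp

lemma SymPos.diag (hp : SymPos E) (r s : ℕ) :
    E (∑ a : Fin n × Fin n, (gen n ^ r) a.2 a.1 * (gen n ^ s) a.2 a.1) = E (trp n (r + s)) :=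
  hp.congr fun A hA => by
    simp only [map_sum, map_mul, ev_gen_pow, ev_trp]; exact tr_mul_symm hA r s

lemma SymPos.diag' (hp : SymPos E) (r s : ℕ) :
    E (∑ a : Fin n × Fin n, (gen n ^ r) a.2 a.1 * (gen n ^ s) a.1 a.2) = E (trp n (r + s)) :=
  hp.congr fun A hA => by
    simp only [map_sum, map_mul, ev_gen_pow, ev_trp]
    rw [← tr_mul_symm hA r s]
    exact Finset.sum_congr rfl fun a _ => by rw [symm_pow hA s]

lemma SymPos.tot_mul (hp : SymPos E) (r s : ℕ) :
    E (tot n r * tot n s) ≤ (n:ℝ) ^ 2 * ((E (trp n (2 * r)) + E (trp n (2 * s))) / 2) := by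
  have := hp (tot n r * tot n s) (((n:ℝ) ^ 2 / 2) • (trp n (2 * r) + trp n (2 * s))) fun A hA => by
    rw [map_mul, smul_eq_C_mul, map_mul, map_add, ev_trp, ev_trp]
    refine (tot_mul_le hA r s).trans (le_of_eq ?_)
    simp only [ev, eval_C]; ring
  refine this.trans (le_of_eq ?_)
  rw [map_smul, map_add, smul_eq_mul]; ring

lemma trCov {δ : ℝ} (hδ : 0 ≤ δ) (hn : 0 < n) (hE : IsWick E (SY n δ)) (hp : SymPos E) (p q : ℕ) :
    E (trp n p * trp n q) ≤ E (trp n p) * E (trp n q) +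
      (p * q : ℝ) * (2 / n * E (trp n ((p - 1) + (q - 1))) +
        δ * n * ((E (trp n (2 * (p - 1))) + E (trp n (2 * (q - 1)))) / 2)) := by
  refine (hE.cov_le (SY_nonneg hδ) (NN_trp n p) (NN_trp n q)).trans ?_
  gcongr
  have hn' : (n:ℝ) ≠ 0 := by positivity
  have e : ∑ c, ∑ d, SY n δ c d * E (pderiv c (trp n p) * pderiv d (trp n q))
      = (p * q : ℝ) * (1 / n) * (E (trp n ((p - 1) + (q - 1))) + E (trp n ((p - 1) + (q - 1)))
        + δ * E (tot n (p - 1) * tot n (q - 1))) := by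
    have h1 : ∀ c d : Fin n × Fin n, SY n δ c d * E (pderiv c (trp n p) * pderiv d (trp n q)) =
      (p * q : ℝ) * (1 / n) * ((if d = c then (1:ℝ) else 0) * E ((gen n ^ (p-1)) c.2 c.1 * (gen n ^ (q-1)) d.2 d.1)
        + (if d = c.swap then (1:ℝ) else 0) * E ((gen n ^ (p-1)) c.2 c.1 * (gen n ^ (q-1)) d.2 d.1)
        + δ * E ((gen n ^ (p-1)) c.2 c.1 * (gen n ^ (q-1)) d.2 d.1)) := by
      intro c d
      rw [pderiv_trp, pderiv_trp, smul_mul_smul_comm, map_smul, smul_eq_mul, SY]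
      ring
    simp only [h1, ← Finset.mul_sum, Finset.sum_add_distrib]
    congr 2
    · congr 1
      · rw [← hp.diag, map_sum]; simp
      · rw [← hp.diag', map_sum]; simp
    · simp only [← map_sum, ← Finset.mul_sum, ← Finset.sum_mul]
      rw [tot_eq_swap, tot_eq_swap]
  rw [e]
  have h2 := hp.tot_mul (p - 1) (q - 1)
  have h3 : (p * q : ℝ) * (1 / n) * (δ * E (tot n (p - 1) * tot n (q - 1))) ≤
     (p * q : ℝ) * (1 / n) * (δ * ((n:ℝ) ^ 2 * ((E (trp n (2 * (p-1))) + E (trp n (2 * (q-1)))) / 2))) := by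
    gcongr
  have h4 : (p * q : ℝ) * (1 / n) * (δ * ((n:ℝ) ^ 2 * ((E (trp n (2 * (p-1))) + E (trp n (2 * (q-1)))) / 2)))
    = (p * q : ℝ) * (δ * n * ((E (trp n (2 * (p - 1))) + E (trp n (2 * (q - 1)))) / 2)) := by
    field_simp
  rw [h4] at h3
  rw [mul_add, mul_add (_ * _) (2 / (n:ℝ) * _)]
  refine add_le_add (le_of_eq ?_) h3
  ring

lemma SG_eq : SG n = SY n 0 := by
  funext a b; simp [SG, SY]

lemma goe_rec (hE : IsWick E (SG n)) (hp : SymPos E) (m : ℕ) :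
    E (trp n (m + 2)) = (1 / n) * ∑ r ∈ Finset.range (m + 1),
      (E (trp n r * trp n (m - r)) + E (trp n m)) := by
  rw [hE.trp_succ (m + 1), Finset.mul_sum]
  refine Finset.sum_congr rfl fun r hr => ?_
  have := Finset.mem_range.mp hr
  have h1 := E_swap E r (m - r)
  have h2 := E_diag E r (m - r)
  rw [hp.diag, show r + (m - r) = m by omega] at h2
  rw [← h1, ← h2, ← Finset.sum_add_distrib, Finset.mul_sum]
  refine Finset.sum_congr rfl fun a _ => ?_
  rw [← Finset.sum_add_distrib, Finset.mul_sum]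
  refine Finset.sum_congr rfl fun b _ => ?_
  rw [SG]
  simp only [Nat.add_sub_cancel]; ring

lemma goe_bound (hn : 0 < n) (hE : IsWick E (SG n)) (hp : SymPos E) (N : ℕ) {θ : ℝ} (h1 : 1 ≤ θ)
    (hθ : 1 + (N:ℝ) / n + 2 * (N:ℝ) ^ 3 / n ^ 2 ≤ θ ^ 2) :
    ∀ k ≤ N, E (trp n k) ≤ n * θ ^ k * cs k := by
  intro k
  have hE' : IsWick E (SY n 0) := SG_eq (n := n) ▸ hE
  have hn' : (0:ℝ) < n := by positivity
  have hnn := trp_nonneg le_rfl hE'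
  have hθ0 : 0 ≤ θ := by linarith
  induction k using Nat.strong_induction_on with
  | _ k ih =>
    intro hk
    match k with
    | 0 => rw [E_trp_zero hE]; simp [cs_zero]
    | 1 => rw [hE.trp_succ 0]; simp [cs_one]
    | m + 2 =>
      rw [goe_rec hE hp]
      have hb : ∀ r ∈ Finset.range (m + 1), E (trp n r * trp n (m - r)) + E (trp n m) ≤
          n ^ 2 * θ ^ m * (cs r * cs (m - r)) + θ ^ m * cs (m + 2) * (2 * N ^ 2 + n) := by
        intro r hr
        have hr' := Finset.mem_range.mp hr
        have c1 := trCov le_rfl hn hE' hp r (m - r)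
        have c2 : E (trp n r) * E (trp n (m - r)) ≤ n ^ 2 * θ ^ m * (cs r * cs (m - r)) := by
          have := mul_le_mul (ih r (by omega) (by omega)) (ih (m - r) (by omega) (by omega))
            (hnn _) (by have := cs_nonneg r; positivity)
          refine this.trans (le_of_eq ?_)
          have : θ ^ m = θ ^ r * θ ^ (m - r) := by rw [← pow_add]; congr 1; omega
          rw [this]; ring
        have c3 : E (trp n m) ≤ n * θ ^ m * cs (m + 2) :=
          (ih m (by omega) (by omega)).trans (by gcongr; exact cs_mono2 m)
        have c4 : ((r:ℝ) * ((m - r : ℕ):ℝ)) * (2 / n * E (trp n (r - 1 + (m - r - 1))))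
            ≤ N ^ 2 * 2 * (θ ^ m * cs (m + 2)) := by
          by_cases h : r = 0 ∨ m - r = 0
          · have := cs_nonneg (m + 2)
            rcases h with h | h <;> rw [h] <;> simp <;> positivity
          · push Not at h
            have i1 := ih (r - 1 + (m - r - 1)) (by omega) (by omega)
            obtain ⟨t, ht⟩ : ∃ t, m = t + 2 := ⟨m - 2, by omega⟩
            have e : r - 1 + (m - r - 1) = t := by omega
            rw [e] at i1 ⊢
            have i2 : E (trp n t) ≤ n * (θ ^ m * cs (m + 2)) := by
              refine i1.trans ?_
              rw [mul_assoc]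
              have := cs_nonneg t
              gcongr
              · omega
              · rw [ht]; exact (cs_mono2 t).trans (cs_mono2 _)
            have i3 : (r:ℝ) * ((m - r : ℕ):ℝ) ≤ N ^ 2 := by
              rw [sq]; gcongr <;> omega
            have i4 : 2 / n * E (trp n t) ≤ 2 * (θ ^ m * cs (m + 2)) := by
              rw [div_mul_eq_mul_div, div_le_iff₀ hn']; linarith
            calc _ ≤ (N:ℝ) ^ 2 * (2 * (θ ^ m * cs (m + 2))) := by
                  apply mul_le_mul i3 i4 _ (by positivity)
                  have := hnn t
                  positivity
              _ = _ := by ring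
        simp only [zero_mul, add_zero] at c1
        linarith
      have := Finset.sum_le_sum hb
      rw [Finset.sum_add_distrib (f := fun r => (n:ℝ) ^ 2 * θ ^ m * (cs r * cs (m - r))),
        ← Finset.mul_sum, ← cs_add_two, Finset.sum_const (θ ^ m * cs (m + 2) * (2 * (N:ℝ) ^ 2 + n)),
        Finset.card_range, nsmul_eq_mul] at this
      have hc := cs_nonneg (m + 2)
      have hm : ((m + 1 : ℕ):ℝ) ≤ N := by exact_mod_cast (by omega)
      calc _ ≤ (1 / (n:ℝ)) * (n ^ 2 * θ ^ m * cs (m + 2) +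
              N * (θ ^ m * cs (m + 2) * (2 * N ^ 2 + n))) := by
            gcongr
            refine this.trans ?_
            gcongr
        _ = n * (θ ^ m * cs (m + 2)) * (1 + (N:ℝ) / n + 2 * (N:ℝ) ^ 3 / n ^ 2) := by
            field_simp
            ring
        _ ≤ n * (θ ^ m * cs (m + 2)) * θ ^ 2 := by gcongr
        _ = _ := by ring

end Wig

end PartD

section PartE
namespace Wig
open MvPolynomial

variable {n : ℕ} {EA EY : MvPolynomial (Fin n × Fin n) ℝ →ₗ[ℝ] ℝ}
  {SA : Fin n × Fin n → Fin n × Fin n → ℝ}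

lemma var_bound {δ : ℝ} (hδ : 0 ≤ δ) (hn : 0 < n) (hA : IsWick EA SA) (hY : IsWick EY (SY n δ))
    (hp : SymPos EY) (hS : ∀ a b, |SA a b| ≤ SY n δ a b) (k : ℕ) :
    |EA (trp n k * trp n k) - EA (trp n k) ^ 2| ≤
      (k:ℝ) ^ 2 * (2 / n + δ * n) * EY (trp n (2 * (k - 1))) := by
  have h1 := hA.dom_cov hY hS (NN_trp n k) (NN_trp n k)
  have h2 := trCov hδ hn hY hp k k
  rw [sq (EA _)]
  rw [← two_mul (k - 1)] at h2
  linarith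

lemma mean_bound {δ : ℝ} (hδ : 0 ≤ δ) (hn : 0 < n) (hA : IsWick EA SA) (hY : IsWick EY (SY n δ))
    (hp : SymPos EY) (hS : ∀ a b, |SA a b| ≤ SY n δ a b)
    (hS' : ∀ a b, |SA a b - 1 / (n:ℝ) * (if b = a.swap then 1 else 0)| ≤
      1 / (n:ℝ) * ((if b = a then 1 else 0) + δ)) (m : ℕ) :
    |EA (trp n (m + 2)) - (1 / n) * ∑ r ∈ Finset.range (m + 1), EA (trp n r * trp n (m - r))| ≤
      ∑ r ∈ Finset.range (m + 1), (1 / n + δ * n) *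
        ((EY (trp n (2 * r)) + EY (trp n (2 * (m - r)))) / 2) := by
  have hn' : (0:ℝ) < n := by positivity
  rw [hA.trp_succ (m + 1), Finset.mul_sum, ← Finset.sum_sub_distrib]
  refine (Finset.abs_sum_le_sum_abs _ _).trans (Finset.sum_le_sum fun r hr => ?_)
  simp only [Nat.add_sub_cancel]
  set s := m - r
  rw [← E_swap EA r s, Finset.mul_sum, ← Finset.sum_sub_distrib]
  have e1 : ∀ a : Fin n × Fin n, ∑ b, SA a b * EA ((gen n ^ r) a.2 b.1 * (gen n ^ s) b.2 a.1) -
      1 / n * ∑ b, (if b = a.swap then (1:ℝ) else 0) *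
        EA ((gen n ^ r) a.2 b.1 * (gen n ^ s) b.2 a.1) =
      ∑ b, (SA a b - 1 / (n:ℝ) * (if b = a.swap then 1 else 0)) *
        EA ((gen n ^ r) a.2 b.1 * (gen n ^ s) b.2 a.1) := by
    intro a
    rw [Finset.mul_sum, ← Finset.sum_sub_distrib]
    exact Finset.sum_congr rfl fun b _ => by ring
  simp only [e1]
  have h2 : ∀ a b : Fin n × Fin n, |(SA a b - 1 / (n:ℝ) * (if b = a.swap then 1 else 0)) *
        EA ((gen n ^ r) a.2 b.1 * (gen n ^ s) b.2 a.1)| ≤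
      (1 / (n:ℝ)) * ((if b = a then (1:ℝ) else 0) * EY ((gen n ^ r) a.2 b.1 * (gen n ^ s) b.2 a.1)
        + δ * EY ((gen n ^ r) a.2 b.1 * (gen n ^ s) b.2 a.1)) := by
    intro a b
    rw [abs_mul, ← add_mul, ← mul_assoc]
    exact mul_le_mul (hS' a b) (hA.dom hY hS ((NN_gen_pow _ _ _ _).mul (NN_gen_pow _ _ _ _)))
      (abs_nonneg _) ((abs_nonneg _).trans (hS' a b))
  have h3 : |∑ a, ∑ b, (SA a b - 1 / (n:ℝ) * (if b = a.swap then 1 else 0)) *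
        EA ((gen n ^ r) a.2 b.1 * (gen n ^ s) b.2 a.1)| ≤
      (1 / (n:ℝ)) * (EY (∑ a : Fin n × Fin n, (gen n ^ r) a.2 a.1 * (gen n ^ s) a.2 a.1)
        + δ * EY (tot n r * tot n s)) := by
    rw [← E_diag, ← sum_sum_tot]
    simp only [map_sum, Finset.mul_sum, ← Finset.sum_add_distrib]
    refine (Finset.abs_sum_le_sum_abs _ _).trans (Finset.sum_le_sum fun a _ => ?_)
    refine (Finset.abs_sum_le_sum_abs _ _).trans (Finset.sum_le_sum fun b _ => ?_)
    refine (h2 a b).trans (le_of_eq ?_)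
    rfl
  refine h3.trans ?_
  have h4 : EY (∑ a : Fin n × Fin n, (gen n ^ r) a.2 a.1 * (gen n ^ s) a.2 a.1) ≤
      (EY (trp n (2 * r)) + EY (trp n (2 * s))) / 2 := by
    have := hp (∑ a : Fin n × Fin n, (gen n ^ r) a.2 a.1 * (gen n ^ s) a.2 a.1)
      ((1 / 2 : ℝ) • (trp n (2 * r) + trp n (2 * s))) fun A hA => by
        simp only [map_sum, map_mul, ev_gen_pow, smul_eq_C_mul, map_add, ev_trp]
        refine (tr_mul_le hA r s).trans (le_of_eq ?_)
        simp only [ev, eval_C]; ring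
    rw [map_smul, map_add, smul_eq_mul] at this
    linarith
  have h5 := hp.tot_mul r s
  have h6 : (1 / (n:ℝ)) * (EY (∑ a : Fin n × Fin n, (gen n ^ r) a.2 a.1 * (gen n ^ s) a.2 a.1)
        + δ * EY (tot n r * tot n s)) ≤ (1 / (n:ℝ)) * ((EY (trp n (2 * r)) + EY (trp n (2 * s))) / 2
        + δ * ((n:ℝ) ^ 2 * ((EY (trp n (2 * r)) + EY (trp n (2 * s))) / 2))) := by
    gcongr
  refine h6.trans (le_of_eq ?_)
  field_simp

end Wig

end PartE

section PartF
namespace Wig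
open Matrix

/-- Spectral decomposition of a real symmetric matrix. -/
structure Diag {n : ℕ} (A U : Matrix (Fin n) (Fin n) ℝ) (d : Fin n → ℝ) : Prop where
  l : Uᵀ * U = 1
  r : U * Uᵀ = 1
  eq : A = U * diagonal d * Uᵀ

lemma exists_diag {n : ℕ} {A : Matrix (Fin n) (Fin n) ℝ} (hA : A.IsSymm) :
    ∃ U d, Diag A U d := by
  have hH : A.IsHermitian := by
    rw [Matrix.IsHermitian, conjTranspose_eq_transpose_of_trivial]; exact hA
  have h1 := hH.spectral_theorem
  have hU := (hH.eigenvectorUnitary).2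
  rw [Matrix.mem_unitaryGroup_iff, Matrix.star_eq_conjTranspose, conjTranspose_eq_transpose_of_trivial] at hU
  have hU' := (hH.eigenvectorUnitary).2
  rw [Matrix.mem_unitaryGroup_iff', Matrix.star_eq_conjTranspose, conjTranspose_eq_transpose_of_trivial] at hU'
  refine ⟨hH.eigenvectorUnitary, hH.eigenvalues, hU', hU, ?_⟩
  rw [Unitary.conjStarAlgAut_apply] at h1
  rw [Matrix.star_eq_conjTranspose, conjTranspose_eq_transpose_of_trivial] at h1
  exact h1

variable {n : ℕ} {A B U : Matrix (Fin n) (Fin n) ℝ} {d : Fin n → ℝ}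

lemma Diag.pow (h : Diag A U d) (k : ℕ) : Diag (A ^ k) U (d ^ k) := by
  refine ⟨h.l, h.r, ?_⟩
  induction k with
  | zero => simp [h.r]
  | succ k ih =>
    rw [pow_succ, ih]
    conv_lhs => rw [h.eq]
    calc _ = U * diagonal (d ^ k) * (Uᵀ * U) * diagonal d * Uᵀ := by simp only [Matrix.mul_assoc]
      _ = _ := by rw [h.l, Matrix.mul_one, Matrix.mul_assoc U, diagonal_mul_diagonal]; rfl

lemma Diag.trace (h : Diag A U d) : A.trace = ∑ i, d i := by
  rw [h.eq, Matrix.trace_mul_cycle, h.l, Matrix.one_mul, Matrix.trace_diagonal]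

lemma Diag.trace_pow (h : Diag A U d) (k : ℕ) : (A ^ k).trace = ∑ i, d i ^ k := by
  rw [(h.pow k).trace]; rfl

lemma Diag.add_smul (h : Diag A U d) (b : ℝ) : Diag (A + b • 1) U (fun i => d i + b) := by
  refine ⟨h.l, h.r, ?_⟩
  have : diagonal (fun i => d i + b) = diagonal d + b • (1 : Matrix (Fin n) (Fin n) ℝ) := by
    ext i j; simp [Matrix.diagonal_apply, Matrix.one_apply]; split_ifs <;> simp
  rw [this, Matrix.mul_add, Matrix.add_mul, ← h.eq]
  simp [h.r]

lemma Diag.eigen (h : Diag A U d) :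
    {t : ℝ | ∃ v : Fin n → ℝ, v ≠ 0 ∧ A.mulVec v = t • v} = Set.range d := by
  ext t
  constructor
  · rintro ⟨v, hv, hA⟩
    have h1 : Uᵀ *ᵥ v ≠ 0 := by
      intro h0
      apply hv
      have : U *ᵥ (Uᵀ *ᵥ v) = v := by rw [mulVec_mulVec, h.r, one_mulVec]
      rw [← this, h0, mulVec_zero]
    have h2 : diagonal d *ᵥ (Uᵀ *ᵥ v) = t • (Uᵀ *ᵥ v) := by
      rw [← mulVec_smul, ← hA, h.eq, mulVec_mulVec, mulVec_mulVec, ← Matrix.mul_assoc,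
        ← Matrix.mul_assoc, h.l, Matrix.one_mul]
    obtain ⟨i, hi⟩ := Function.ne_iff.mp h1
    refine ⟨i, ?_⟩
    have := congrFun h2 i
    rw [mulVec_diagonal, Pi.smul_apply, smul_eq_mul] at this
    exact mul_right_cancel₀ hi this
  · rintro ⟨i, rfl⟩
    refine ⟨U *ᵥ Pi.single i 1, ?_, ?_⟩
    · intro h0
      have : Uᵀ *ᵥ (U *ᵥ Pi.single i 1) = Pi.single i 1 := by
        rw [mulVec_mulVec, h.l, one_mulVec]
      rw [h0, mulVec_zero] at this
      have := congrFun this i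
      simp at this
    · rw [h.eq, mulVec_mulVec, Matrix.mul_assoc, h.l, Matrix.mul_one, ← mulVec_mulVec,
        ← mulVec_smul]
      congr 1
      ext j
      rw [mulVec_diagonal]
      by_cases hj : j = i
      · subst hj; simp
      · simp [hj]

lemma peierls (hA : A.IsSymm) {V : Matrix (Fin n) (Fin n) ℝ} (h1 : Vᵀ * V = 1) (h2 : V * Vᵀ = 1)
    (k : ℕ) : ∑ i, ((Vᵀ * A * V) i i) ^ (2 * k) ≤ (A ^ (2 * k)).trace := by
  obtain ⟨U, d, h⟩ := exists_diag hA
  set W := Vᵀ * U with hW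
  have w1 : W * Wᵀ = 1 := by
    rw [hW, transpose_mul, transpose_transpose, Matrix.mul_assoc, ← Matrix.mul_assoc U, h.r,
      Matrix.one_mul, h1]
  have w2 : Wᵀ * W = 1 := by
    rw [hW, transpose_mul, transpose_transpose, Matrix.mul_assoc, ← Matrix.mul_assoc V, h2,
      Matrix.one_mul, h.l]
  have e : Vᵀ * A * V = W * diagonal d * Wᵀ := by
    rw [h.eq, hW, transpose_mul, transpose_transpose]; simp only [Matrix.mul_assoc]
  have e2 : ∀ i, (Vᵀ * A * V) i i = ∑ j, (W i j) ^ 2 * d j := by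
    intro i
    rw [e, Matrix.mul_apply]
    refine Finset.sum_congr rfl fun j _ => ?_
    rw [mul_diagonal, transpose_apply]; ring
  have s1 : ∀ i, ∑ j, (W i j) ^ 2 = 1 := by
    intro i
    have := congrFun (congrFun w1 i) i
    rw [Matrix.mul_apply, Matrix.one_apply_eq] at this
    rw [← this]; exact Finset.sum_congr rfl fun j _ => by rw [transpose_apply, sq]
  have s2 : ∀ j, ∑ i, (W i j) ^ 2 = 1 := by
    intro j
    have := congrFun (congrFun w2 j) j
    rw [Matrix.mul_apply, Matrix.one_apply_eq] at this
    rw [← this]; exact Finset.sum_congr rfl fun i _ => by rw [transpose_apply, sq]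
  rw [h.trace_pow]
  calc _ ≤ ∑ i, ∑ j, (W i j) ^ 2 * d j ^ (2 * k) := by
        refine Finset.sum_le_sum fun i _ => ?_
        rw [e2]
        exact Real.pow_arith_mean_le_arith_mean_pow_of_even _ _ _ (fun j _ => sq_nonneg _) (s1 i)
          (even_two_mul k)
    _ = _ := by
        rw [Finset.sum_comm]
        refine Finset.sum_congr rfl fun j _ => ?_
        rw [← Finset.sum_mul, s2, one_mul]

lemma scalar_split {η : ℝ} (hη : 0 < η) (x y : ℝ) (k : ℕ) :
    (x + y) ^ (2 * k) ≤ (1 + η) ^ (2 * k) * x ^ (2 * k) + (1 + 1 / η) ^ (2 * k) * y ^ (2 * k) := by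
  have hx : 0 ≤ x ^ (2 * k) := by rw [pow_mul]; positivity
  have hy : 0 ≤ y ^ (2 * k) := by rw [pow_mul]; positivity
  have ev : Even (2 * k) := even_two_mul k
  rw [← ev.pow_abs (x + y), ← ev.pow_abs x, ← ev.pow_abs y]
  have h := abs_add_le x y
  rcases le_total |y| (η * |x|) with h1 | h1
  · have : |x + y| ≤ (1 + η) * |x| := by linarith
    have := pow_le_pow_left₀ (abs_nonneg _) this (2 * k)
    rw [mul_pow] at this
    have : 0 ≤ (1 + 1 / η) ^ (2 * k) * |y| ^ (2 * k) := by positivity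
    linarith
  · have : |x| ≤ 1 / η * |y| := by rw [one_div, inv_mul_eq_div, le_div_iff₀ hη]; linarith
    have : |x + y| ≤ (1 + 1 / η) * |y| := by linarith
    have := pow_le_pow_left₀ (abs_nonneg _) this (2 * k)
    rw [mul_pow] at this
    have : 0 ≤ (1 + η) ^ (2 * k) * |x| ^ (2 * k) := by positivity
    linarith

lemma trace_split (hA : A.IsSymm) (hB : B.IsSymm) {η : ℝ} (hη : 0 < η) (k : ℕ) :
    ((A + B) ^ (2 * k)).trace ≤ (1 + η) ^ (2 * k) * (A ^ (2 * k)).trace +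
      (1 + 1 / η) ^ (2 * k) * (B ^ (2 * k)).trace := by
  obtain ⟨V, c, h⟩ := exists_diag (hA.add hB)
  have e : ∀ i, c i = (Vᵀ * A * V) i i + (Vᵀ * B * V) i i := by
    intro i
    rw [← Matrix.add_apply, ← Matrix.add_mul, ← Matrix.mul_add, h.eq]
    have : Vᵀ * (V * diagonal c * Vᵀ) * V = diagonal c := by
      calc _ = (Vᵀ * V) * diagonal c * (Vᵀ * V) := by simp only [Matrix.mul_assoc]
        _ = _ := by rw [h.l]; simp
    rw [this, diagonal_apply_eq]
  rw [h.trace_pow]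
  calc _ ≤ ∑ i, ((1 + η) ^ (2 * k) * (Vᵀ * A * V) i i ^ (2 * k) +
            (1 + 1 / η) ^ (2 * k) * (Vᵀ * B * V) i i ^ (2 * k)) := by
        refine Finset.sum_le_sum fun i _ => ?_
        rw [e i]; exact scalar_split hη _ _ k
    _ ≤ _ := by
        rw [Finset.sum_add_distrib, ← Finset.mul_sum, ← Finset.mul_sum]
        gcongr
        · exact peierls hA h.l h.r k
        · exact peierls hB h.l h.r k

lemma trace_ones (n : ℕ) (c : ℝ) (k : ℕ) (hk : 1 ≤ k) :
    ((Matrix.of fun _ _ : Fin n => c) ^ k).trace = (c * n) ^ k := by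
  have h : ∀ j, (Matrix.of fun _ _ : Fin n => c) ^ (j + 1) = Matrix.of fun _ _ => c * (c * n) ^ j := by
    intro j
    induction j with
    | zero => simp
    | succ j ih =>
      rw [pow_succ, ih]
      ext a b
      simp [Matrix.mul_apply]; ring
  obtain ⟨j, rfl⟩ : ∃ j, k = j + 1 := ⟨k - 1, by omega⟩
  rw [h]
  simp [Matrix.trace]; ring

end Wig

end PartF

section PartG
namespace Wig

lemma gauss_moment (k : ℕ) : ∫ x, x ^ (2 * k) ∂(gaussianReal 0 1) ≤ (2 * k : ℝ) ^ k := by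
  induction k with
  | zero => simp
  | succ k ih =>
    have := stein_real (Polynomial.X ^ (2 * k + 1)) 1
    simp only [Polynomial.eval_pow, Polynomial.eval_X, Polynomial.derivative_X_pow,
      Polynomial.eval_mul, Polynomial.eval_C, NNReal.coe_one, one_mul,
      Nat.add_sub_cancel] at this
    rw [show 2 * (k + 1) = (2 * k + 1) + 1 by ring]
    simp only [pow_succ' _ (2 * k + 1)]
    rw [this, integral_const_mul]
    push_cast
    calc (2 * (k:ℝ) + 1) * ∫ x, x ^ (2 * k) ∂(gaussianReal 0 1)
        ≤ (2 * (k:ℝ) + 1) * (2 * k : ℝ) ^ k := by gcongr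
      _ ≤ (2 * (k + 1 : ℝ)) * (2 * (k + 1 : ℝ)) ^ k := by gcongr <;> linarith
      _ = _ := by ring

/-- Standard Gaussian measure on a finite product. -/
noncomputable abbrev stdG (W : Type*) [Fintype W] : Measure (W → ℝ) :=
  Measure.pi fun _ => gaussianReal 0 1

lemma stdG_cov {W : Type*} [Fintype W] [DecidableEq W] (w w' : W) :
    ∫ g, g w * g w' ∂(stdG W) = if w = w' then 1 else 0 := by
  have hmp : ∀ w : W, MeasurePreserving (Function.eval w) (stdG W) (gaussianReal 0 1) :=
    fun w => measurePreserving_eval _ w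
  split_ifs with h
  · subst h
    have h1 : ∫ g, g w * g w ∂(stdG W) = ∫ x, x * x ∂(gaussianReal 0 1) := by
      rw [← (hmp w).map_eq, integral_map (measurable_pi_apply w).aemeasurable (by fun_prop)]
    rw [h1]
    have := stein_real Polynomial.X 1
    simpa using this
  · have hi : iIndepFun (fun (w : W) (g : W → ℝ) => g w) (stdG W) :=
      iIndepFun_pi (X := fun _ => id) (fun _ => aemeasurable_id)
    have h2 := hi.indepFun h
    have h3 := h2.integral_fun_mul_eq_mul_integral
      (measurable_pi_apply w).aestronglyMeasurable (measurable_pi_apply w').aestronglyMeasurable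
    rw [h3]
    have h1 : ∫ g, g w ∂(stdG W) = ∫ x, x ∂(gaussianReal 0 1) := by
      rw [← (hmp w).map_eq, integral_map (measurable_pi_apply w).aemeasurable (by fun_prop)]
    rw [h1, integral_id_gaussianReal, zero_mul]

lemma stdG_gauss {W : Type*} [Fintype W] : HasGaussianLaw (fun g : W → ℝ => g) (stdG W) := by
  have hi : iIndepFun (fun (w : W) (g : W → ℝ) => g w) (stdG W) :=
      iIndepFun_pi (X := fun _ => id) (fun _ => aemeasurable_id)
  exact hi.hasGaussianLaw fun w => 
    ⟨by rw [(measurePreserving_eval _ w).map_eq]; infer_instance⟩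

lemma model {V W : Type*} [Fintype V] [Fintype W] (c : V → W → ℝ) :
    ∃ E : MvPolynomial V ℝ →ₗ[ℝ] ℝ, IsWick E (fun a b => ∑ w, c a w * c b w) ∧
      (∀ p, E p = ∫ g, MvPolynomial.eval (fun a => ∑ w, c a w * g w) p ∂(stdG W)) ∧
      ∀ p, Integrable (fun g => MvPolynomial.eval (fun a => ∑ w, c a w * g w) p) (stdG W) := by
  classical
  have hintg : ∀ w, Integrable (fun g : W → ℝ => g w) (stdG W) := fun w =>
    ((stdG_gauss.eval w).memLp (p := 1) (by simp)).integrable le_rfl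
  have hintg2 : ∀ w w', Integrable (fun g : W → ℝ => g w * g w') (stdG W) := fun w w' =>
    ((stdG_gauss.eval w).memLp (p := 2) (by simp)).integrable_mul
      ((stdG_gauss.eval w').memLp (p := 2) (by simp))
  obtain ⟨E, h1, h2, h3⟩ := exists_isWick (μ := stdG W) (X := fun a g => ∑ w, c a w * g w)
    (fun a => by fun_prop) (by
      have := stdG_gauss (W := W) |>.map
        (L := (ContinuousLinearMap.pi fun a : V => ∑ w, c a w •
          (ContinuousLinearMap.proj (R := ℝ) (φ := fun _ : W => ℝ) w : (W → ℝ) →L[ℝ] ℝ) :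
          (W → ℝ) →L[ℝ] (V → ℝ)))
      have e : (fun (g : W → ℝ) (a : V) => ∑ w, c a w * g w) =
          (ContinuousLinearMap.pi fun a : V => ∑ w, c a w •
          (ContinuousLinearMap.proj (R := ℝ) (φ := fun _ : W => ℝ) w : (W → ℝ) →L[ℝ] ℝ) :
          (W → ℝ) →L[ℝ] (V → ℝ)) ∘ fun g => g := by
        funext g a; simp
      rw [e]; exact this) (by
      intro a
      rw [integral_finsetSum _ fun w _ => (hintg w).const_mul _]
      refine Finset.sum_eq_zero fun w _ => ?_
      have h1 : ∫ g, g w ∂(stdG W) = ∫ x, x ∂(gaussianReal 0 1) := by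
        rw [← (measurePreserving_eval (fun _ : W => gaussianReal 0 1) w).map_eq,
          integral_map (measurable_pi_apply w).aemeasurable (by fun_prop)]
      rw [integral_const_mul, h1, integral_id_gaussianReal, mul_zero])
  refine ⟨E, ?_, h2, h3⟩
  convert h1 using 3 with a b
  simp only [Finset.sum_mul_sum]
  rw [integral_finsetSum _ fun w _ => ?_]
  · refine Finset.sum_congr rfl fun w _ => ?_
    have e : ∀ w' (g : W → ℝ), c a w * g w * (c b w' * g w') = (c a w * c b w') * (g w * g w') := by
      intros; ring
    simp only [e]
    rw [integral_finsetSum _ fun w' _ => (hintg2 w w').const_mul _]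
    simp only [integral_const_mul, stdG_cov]
    simp
  · refine integrable_finsetSum _ fun w' _ => ?_
    have e : ∀ (g : W → ℝ), c a w * g w * (c b w' * g w') = (c a w * c b w') * (g w * g w') := by
      intros; ring
    simp only [e]
    exact (hintg2 w w').const_mul _


lemma SymPos_of_integral {n : ℕ} {Ω : Type*} [MeasurableSpace Ω] {μ : Measure Ω}
    {E : MvPolynomial (Fin n × Fin n) ℝ →ₗ[ℝ] ℝ} (Y : Ω → Matrix (Fin n) (Fin n) ℝ)
    (hs : ∀ ω, (Y ω).IsSymm) (h : ∀ p, E p = ∫ ω, ev (Y ω) p ∂μ)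
    (hi : ∀ p, Integrable (fun ω => ev (Y ω) p) μ) : SymPos E := by
  intro p q hpq
  rw [h, h]
  exact integral_mono (hi p) (hi q) fun ω => hpq _ (hs ω)

/-- coefficients of the GOE-type part. -/
noncomputable def cG (n : ℕ) (s : ℝ) (a : Fin n × Fin n) : Option (Fin n × Fin n) → ℝ
  | none => s
  | some w => (Real.sqrt (2 * n))⁻¹ * ((if w = a then 1 else 0) + (if w = a.swap then 1 else 0))

lemma cG_sum (n : ℕ) (s : ℝ) (a b : Fin n × Fin n) :
    ∑ w, cG n s a w * cG n s b w = s ^ 2 + SG n a b := by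
  rw [Fintype.sum_option]
  simp only [cG]
  rw [← sq s]
  congr 1
  have : ∀ w : Fin n × Fin n, (Real.sqrt (2 * n))⁻¹ * ((if w = a then (1:ℝ) else 0) + (if w = a.swap then 1 else 0)) *
      ((Real.sqrt (2 * n))⁻¹ * ((if w = b then 1 else 0) + (if w = b.swap then 1 else 0))) =
      ((Real.sqrt (2 * n)) ^ 2)⁻¹ * ((if w = a then ((if w = b then (1:ℝ) else 0) + (if w = b.swap then 1 else 0)) else 0)
       + (if w = a.swap then ((if w = b then (1:ℝ) else 0) + (if w = b.swap then 1 else 0)) else 0)) := by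
    intro w
    split_ifs <;> ring
  simp only [this]
  rw [← Finset.mul_sum, Finset.sum_add_distrib, Finset.sum_ite_eq', Finset.sum_ite_eq',
    if_pos (Finset.mem_univ _), if_pos (Finset.mem_univ _), Real.sq_sqrt (by positivity), SG]
  have e1 : (a = b) ↔ (b = a) := eq_comm
  have e2 : (a = b.swap) ↔ (b = a.swap) := by
    rw [eq_comm]; exact Prod.swap_eq_iff_eq_swap
  have e3 : (a.swap = b) ↔ (b = a.swap) := eq_comm
  have e4 : (a.swap = b.swap) ↔ (b = a) := by
    rw [eq_comm]; exact Prod.swap_inj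
  rw [if_congr e1 rfl rfl, if_congr e2 rfl rfl, if_congr e3 rfl rfl, if_congr e4 rfl rfl]
  rw [mul_inv]
  ring

theorem models (n : ℕ) (hn : 0 < n) {δ : ℝ} (hδ : 0 ≤ δ) :
    ∃ EG EY : MvPolynomial (Fin n × Fin n) ℝ →ₗ[ℝ] ℝ,
      IsWick EG (SG n) ∧ SymPos EG ∧ IsWick EY (SY n δ) ∧ SymPos EY ∧
      ∀ k : ℕ, 1 ≤ k → ∀ η : ℝ, 0 < η → EY (trp n (2 * k)) ≤
        (1 + η) ^ (2 * k) * EG (trp n (2 * k)) +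
          (1 + 1 / η) ^ (2 * k) * (δ * n * (2 * k)) ^ k := by
  have hn' : (0:ℝ) < n := by positivity
  obtain ⟨EG, g1, g2, g3⟩ := model (cG n 0)
  obtain ⟨EY, y1, y2, y3⟩ := model (cG n (Real.sqrt (δ / n)))
  let G : ℝ → (Option (Fin n × Fin n) → ℝ) → Matrix (Fin n) (Fin n) ℝ :=
    fun s g => Matrix.of fun i j => ∑ w, cG n s (i, j) w * g w
  have hG : ∀ s g, (G s g).IsSymm := by
    intro s g
    ext i j
    simp only [G, Matrix.transpose_apply, Matrix.of_apply]
    refine Finset.sum_congr rfl fun w _ => ?_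
    congr 1
    cases w with
    | none => rfl
    | some w => simp only [cG, Prod.swap_prod_mk]; ring
  have hev : ∀ s g p, MvPolynomial.eval (fun a => ∑ w, cG n s a w * g w) p = ev (G s g) p := by
    intro s g p; rfl
  simp only [hev] at g2 g3 y2 y3
  refine ⟨EG, EY, ?_, SymPos_of_integral _ (hG 0) g2 g3, ?_, SymPos_of_integral _ (hG _) y2 y3, ?_⟩
  · convert g1 using 3 with a b
    rw [cG_sum]; ring
  · convert y1 using 3 with a b
    rw [cG_sum, Real.sq_sqrt (by positivity), SG, SY]
    ring
  · intro k hk η hη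
    set s := Real.sqrt (δ / n) with hs
    have hs2 : s ^ 2 = δ / n := Real.sq_sqrt (by positivity)
    have hintg : Integrable (fun g : Option (Fin n × Fin n) → ℝ => g none ^ (2 * k)) (stdG _) := by
      have := (measurePreserving_eval (fun _ : Option (Fin n × Fin n) => gaussianReal 0 1) none)
      have h2 := memLp_poly_real (Polynomial.X ^ (2 * k)) 1
      simp only [Polynomial.eval_pow, Polynomial.eval_X] at h2
      exact this.integrable_comp_of_integrable h2
    have hmom : ∫ g : Option (Fin n × Fin n) → ℝ, g none ^ (2 * k) ∂(stdG _) ≤ (2 * k : ℝ) ^ k := by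
      have e : ∫ g : Option (Fin n × Fin n) → ℝ, g none ^ (2 * k) ∂(stdG _) =
          ∫ x, x ^ (2 * k) ∂(gaussianReal 0 1) := by
        rw [← (measurePreserving_eval (fun _ : Option (Fin n × Fin n) => gaussianReal 0 1)
          none).map_eq, integral_map (measurable_pi_apply none).aemeasurable (by fun_prop)]
      rw [e]; exact gauss_moment k
    have hpt : ∀ g, ev (G s g) (trp n (2 * k)) ≤ (1 + η) ^ (2 * k) * ev (G 0 g) (trp n (2 * k)) +
        (1 + 1 / η) ^ (2 * k) * ((δ * n) ^ k * g none ^ (2 * k)) := by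
      intro g
      have e : G s g = G 0 g + Matrix.of fun _ _ => s * g none := by
        ext i j
        simp only [G, Matrix.of_apply, Matrix.add_apply, Fintype.sum_option, cG]
        ring
      have hB : (Matrix.of fun _ _ : Fin n => s * g none).IsSymm := by
        ext i j; rfl
      rw [ev_trp, ev_trp, e]
      refine (trace_split (hG 0 g) hB hη k).trans (le_of_eq ?_)
      rw [trace_ones _ _ _ (by omega)]
      congr 2
      rw [pow_mul, pow_mul, ← mul_pow]
      congr 1
      rw [mul_pow, mul_pow, hs2]
      field_simp
    rw [y2, g2]
    calc _ ≤ ∫ g, ((1 + η) ^ (2 * k) * ev (G 0 g) (trp n (2 * k)) +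
        (1 + 1 / η) ^ (2 * k) * ((δ * n) ^ k * g none ^ (2 * k))) ∂(stdG _) :=
          integral_mono (y3 _) (((g3 _).const_mul _).add ((hintg.const_mul _).const_mul _)) hpt
      _ = (1 + η) ^ (2 * k) * ∫ g, ev (G 0 g) (trp n (2 * k)) ∂(stdG _) +
          (1 + 1 / η) ^ (2 * k) * ((δ * n) ^ k * ∫ g, g none ^ (2 * k) ∂(stdG _)) := by
          rw [integral_add ((g3 _).const_mul _) ((hintg.const_mul _).const_mul _),
            integral_const_mul, integral_const_mul, integral_const_mul]
      _ ≤ _ := by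
          rw [mul_pow (δ * n)]
          gcongr

end Wig

end PartG

section PartH
namespace Wig

lemma gaussVec {Ω : Type*} [MeasureSpace Ω] [IsProbabilityMeasure (volume : Measure Ω)]
    {ι : Type*} [Fintype ι] {X : ι → Ω → ℝ} (h : IsCenteredGaussianVec X) :
    HasGaussianLaw (fun ω i => X i ω) (volume : Measure Ω) ∧ ∀ i, ∫ ω, X i ω = 0 := by
  classical
  obtain ⟨hm, hc⟩ := h
  constructor
  · refine ⟨isGaussian_of_map_eq_gaussianReal fun L => ?_⟩
    obtain ⟨v, hv⟩ := hc fun i => L (Pi.single i 1)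
    refine ⟨0, v, ?_⟩
    rw [← hv, Measure.map_map (by fun_prop) (measurable_pi_lambda _ hm)]
    congr 1
    funext ω
    simp only [Function.comp]
    have : (fun i => X i ω) = ∑ i, X i ω • (Pi.single i (1:ℝ) : ι → ℝ) := by
      funext j
      simp [Finset.sum_apply, Pi.single_apply]
    rw [this, map_sum]
    exact Finset.sum_congr rfl fun i _ => by rw [map_smul, smul_eq_mul, mul_comm]
  · intro i
    obtain ⟨v, hv⟩ := hc (Pi.single i 1)
    have e : (fun ω => ∑ j, (Pi.single i (1:ℝ) : ι → ℝ) j * X j ω) = X i := by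
      funext ω; simp [Pi.single_apply]
    rw [e] at hv
    have := integral_map (μ := (volume : Measure Ω)) (hm i).aemeasurable (f := fun x : ℝ => x)
      (by fun_prop)
    rw [← this, hv, integral_id_gaussianReal]

variable {Ω : Type*} [MeasureSpace Ω] [IsProbabilityMeasure (volume : Measure Ω)]
  {X : (n : ℕ) → Ω → Matrix (Fin n) (Fin n) ℝ} {C ε : ℝ}

/-- The scaled matrix. -/
noncomputable def AA (X : (n : ℕ) → Ω → Matrix (Fin n) (Fin n) ℝ) (n : ℕ) (ω : Ω) :
    Matrix (Fin n) (Fin n) ℝ := ((n : ℝ) ^ (-(1 / 2) : ℝ)) • X n ω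

/-- The correlation parameter. -/
noncomputable def dl (C ε : ℝ) (n : ℕ) : ℝ := C * (n : ℝ) ^ (-(1 + ε))

lemma AA_symm (hX : CorrGaussian Ω X C ε) (n : ℕ) (ω : Ω) : (AA X n ω).IsSymm :=
  (hX.symm n ω).smul _

lemma setup (hC : 0 < C) (hX : CorrGaussian Ω X C ε) (n : ℕ) (hn : 0 < n) :
    ∃ (EA : MvPolynomial (Fin n × Fin n) ℝ →ₗ[ℝ] ℝ) (SA : Fin n × Fin n → Fin n × Fin n → ℝ),
      IsWick EA SA ∧ (∀ p, EA p = ∫ ω, ev (AA X n ω) p) ∧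
      (∀ p, Integrable fun ω => ev (AA X n ω) p) ∧
      (∀ a b, |SA a b| ≤ SY n (dl C ε n) a b) ∧
      (∀ a b, |SA a b - 1 / (n:ℝ) * (if b = a.swap then 1 else 0)| ≤
      1 / (n:ℝ) * ((if b = a then 1 else 0) + dl C ε n)) := by
  have hn' : (0:ℝ) < n := by positivity
  have hd : 0 ≤ dl C ε n := by unfold dl; positivity
  have hgv : IsCenteredGaussianVec fun p : Fin n × Fin n => fun ω => AA X n ω p.1 p.2 := by
    obtain ⟨hm, hc⟩ := hX.gauss n
    refine ⟨fun i => ?_, fun c => ?_⟩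
    · simp only [AA, Matrix.smul_apply, smul_eq_mul]; exact (hm i).const_mul _
    · obtain ⟨v, hv⟩ := hc fun i => c i * ((n : ℝ) ^ (-(1 / 2) : ℝ))
      refine ⟨v, ?_⟩
      rw [← hv]
      congr 1
      funext ω
      exact Finset.sum_congr rfl fun i _ => by
        simp only [AA, Matrix.smul_apply, smul_eq_mul]; ring
  obtain ⟨hL, h0⟩ := gaussVec hgv
  obtain ⟨EA, e1, e2, e3⟩ := exists_isWick hgv.1 hL h0
  have hcov : ∀ a b : Fin n × Fin n, ∫ ω, AA X n ω a.1 a.2 * AA X n ω b.1 b.2 =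
      1 / n * ∫ ω, X n ω a.1 a.2 * X n ω b.1 b.2 := by
    intro a b
    rw [← integral_const_mul]
    congr 1
    funext ω
    simp only [AA, Matrix.smul_apply, smul_eq_mul]
    have : ((n : ℝ) ^ (-(1 / 2) : ℝ)) * ((n : ℝ) ^ (-(1 / 2) : ℝ)) = 1 / n := by
      rw [← Real.rpow_add hn', one_div (n:ℝ), ← Real.rpow_neg_one]; norm_num
    rw [← this]; ring
  have hself : ∀ a : Fin n × Fin n, ∫ ω, X n ω a.1 a.2 * X n ω a.1 a.2 = 1 := by
    intro a
    rw [← hX.var_one n a.1 a.2]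
    simp only [sq]
  have hswap : ∀ a : Fin n × Fin n, ∫ ω, X n ω a.1 a.2 * X n ω a.swap.1 a.swap.2 = 1 := by
    intro a
    rw [← hself a]
    congr 1
    funext ω
    congr 1
    exact (hX.symm n ω).apply a.1 a.2
  have hoth : ∀ a b : Fin n × Fin n, b ≠ a → b ≠ a.swap →
      |∫ ω, X n ω a.1 a.2 * X n ω b.1 b.2| ≤ dl C ε n := by
    intro a b h1 h2
    refine hX.corr_le n a.1 a.2 b.1 b.2 ?_
    rintro (h | h)
    · exact h1 h.symm
    · apply h2
      have : a = b.swap := h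
      rw [this, Prod.swap_swap]
  refine ⟨EA, _, e1, e2, e3, fun a b => ?_, fun a b => ?_⟩
  · rw [hcov, SY, abs_mul, abs_of_nonneg (by positivity : (0:ℝ) ≤ 1 / n)]
    gcongr
    by_cases h1 : b = a
    · subst h1
      rw [hself, abs_one, if_pos rfl]
      have : (0:ℝ) ≤ if b = b.swap then 1 else 0 := by positivity
      linarith
    · by_cases h2 : b = a.swap
      · subst h2
        rw [hswap, abs_one, if_pos rfl]
        have : (0:ℝ) ≤ if a.swap = a then 1 else 0 := by positivity
        linarith
      · rw [if_neg h1, if_neg h2, zero_add, zero_add]; exact hoth a b h1 h2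
  · rw [hcov, ← mul_sub, abs_mul, abs_of_nonneg (by positivity : (0:ℝ) ≤ 1 / n)]
    gcongr
    by_cases h2 : b = a.swap
    · subst h2
      rw [hswap, if_pos rfl, sub_self, abs_zero]
      positivity
    · rw [if_neg h2, sub_zero]
      by_cases h1 : b = a
      · subst h1
        rw [hself, abs_one, if_pos rfl]
        linarith
      · rw [if_neg h1, zero_add]; exact hoth a b h1 h2

end Wig

end PartH

section PartI
namespace Wig

/-- Range of validity of the moment bound. -/
def Cnd (δ η : ℝ) (n k : ℕ) : Prop :=
  1 + ((2 * k : ℕ) : ℝ) / n + 2 * ((2 * k : ℕ) : ℝ) ^ 3 / n ^ 2 ≤ (1 + η) ^ 2 ∧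
    (1 + 1 / η) ^ 2 * (δ * n * (2 * k)) ≤ 1

lemma Cnd.mono {δ η : ℝ} (hδ : 0 ≤ δ) {n k j : ℕ} (h : Cnd δ η n k) (hj : j ≤ k) :
    Cnd δ η n j := by
  obtain ⟨h1, h2⟩ := h
  refine ⟨le_trans ?_ h1, le_trans ?_ h2⟩ <;> gcongr

/-- The models, with the moment bound. -/
lemma modelY (n : ℕ) (hn : 0 < n) {δ : ℝ} (hδ : 0 ≤ δ) :
    ∃ EY : MvPolynomial (Fin n × Fin n) ℝ →ₗ[ℝ] ℝ, IsWick EY (SY n δ) ∧ SymPos EY ∧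
      ∀ η : ℝ, 0 < η → ∀ k, Cnd δ η n k →
        EY (trp n (2 * k)) ≤ 2 * n * (2 * (1 + η) ^ 2) ^ (2 * k) := by
  obtain ⟨EG, EY, g1, g2, y1, y2, h⟩ := models n hn hδ
  refine ⟨EY, y1, y2, fun η hη k hk => ?_⟩
  have hn' : (1:ℝ) ≤ n := by exact_mod_cast hn
  rcases Nat.eq_zero_or_pos k with rfl | hk0
  · simp only [mul_zero, pow_zero]; rw [E_trp_zero y1]; linarith
  have h1 := h k hk0 η hη
  have h2 := goe_bound hn g1 g2 (2 * k) (θ := 1 + η) (by linarith) hk.1 (2 * k) le_rfl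
  have h3 : EG (trp n (2 * k)) ≤ n * (1 + η) ^ (2 * k) * 2 ^ (2 * k) :=
    h2.trans (by gcongr; exact cs_le _)
  have h4 : (1 + 1 / η) ^ (2 * k) * (δ * n * (2 * k)) ^ k ≤ 1 := by
    rw [pow_mul, ← mul_pow]
    exact pow_le_one₀ (by positivity) hk.2
  have h5 : (1:ℝ) ≤ (2 * (1 + η) ^ 2) ^ (2 * k) := one_le_pow₀ (by nlinarith)
  have h6 : (1 + η) ^ (2 * k) * EG (trp n (2 * k)) ≤ n * (2 * (1 + η) ^ 2) ^ (2 * k) := by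
    calc _ ≤ (1 + η) ^ (2 * k) * (n * (1 + η) ^ (2 * k) * 2 ^ (2 * k)) := by gcongr
      _ = _ := by rw [mul_pow, ← pow_mul (1 + η) 2, mul_comm 2 (2 * k), pow_mul (1 + η) (2 * k) 2]; ring
  nlinarith

variable {Ω : Type*} [MeasureSpace Ω] [IsProbabilityMeasure (volume : Measure Ω)]
  {X : (n : ℕ) → Ω → Matrix (Fin n) (Fin n) ℝ} {C ε : ℝ}

/-- traces of powers of the scaled matrix -/
noncomputable def tA (X : (n : ℕ) → Ω → Matrix (Fin n) (Fin n) ℝ) (n k : ℕ) (ω : Ω) : ℝ :=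
  (AA X n ω ^ k).trace

lemma tA_int (hC : 0 < C) (hX : CorrGaussian Ω X C ε) {n : ℕ} (hn : 0 < n) (k : ℕ) :
    Integrable (tA X n k) := by
  obtain ⟨EA, SA, a1, a2, a3, a4, a5⟩ := setup hC hX n hn
  have := a3 (trp n k)
  simp only [ev_trp] at this
  exact this

lemma tA_mul_int (hC : 0 < C) (hX : CorrGaussian Ω X C ε) {n : ℕ} (hn : 0 < n) (k l : ℕ) :
    Integrable (fun ω => tA X n k ω * tA X n l ω) := by
  obtain ⟨EA, SA, a1, a2, a3, a4, a5⟩ := setup hC hX n hn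
  have := a3 (trp n k * trp n l)
  simp only [map_mul, ev_trp] at this
  exact this

lemma dl_nonneg (hC : 0 < C) (n : ℕ) : 0 ≤ dl C ε n := by unfold dl; positivity

lemma bound1 (hC : 0 < C) (hX : CorrGaussian Ω X C ε) {n : ℕ} (hn : 0 < n) {η : ℝ} (hη : 0 < η)
    {k : ℕ} (hk : Cnd (dl C ε n) η n k) :
    ∫ ω, tA X n (2 * k) ω ≤ 2 * n * (2 * (1 + η) ^ 2) ^ (2 * k) := by
  obtain ⟨EA, SA, a1, a2, a3, a4, a5⟩ := setup hC hX n hn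
  obtain ⟨EY, y1, y2, y3⟩ := modelY n hn (dl_nonneg (ε := ε) hC n)
  have h1 := a1.dom y1 a4 (NN_trp n (2 * k))
  rw [a2] at h1
  simp only [ev_trp] at h1
  exact (le_abs_self _).trans (h1.trans (y3 η hη k hk))

lemma bound2 (hC : 0 < C) (hX : CorrGaussian Ω X C ε) {n : ℕ} (hn : 0 < n)
    {k : ℕ} (hk : Cnd (dl C ε n) 1 n k) :
    (∫ ω, tA X n k ω * tA X n k ω) - (∫ ω, tA X n k ω) ^ 2 ≤
      (k:ℝ) ^ 2 * (2 / n + dl C ε n * n) * (2 * n * 8 ^ (2 * k)) := by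
  obtain ⟨EA, SA, a1, a2, a3, a4, a5⟩ := setup hC hX n hn
  have hd := (dl_nonneg (ε := ε) hC n)
  obtain ⟨EY, y1, y2, y3⟩ := modelY n hn hd
  have h1 := var_bound hd hn a1 y1 y2 a4 k
  rw [a2, a2] at h1
  simp only [ev_trp, map_mul] at h1
  refine (le_abs_self _).trans (h1.trans ?_)
  gcongr
  refine (y3 1 one_pos (k - 1) (hk.mono hd (by omega))).trans ?_
  norm_num
  gcongr
  · norm_num
  · omega

lemma bound3 (hC : 0 < C) (hX : CorrGaussian Ω X C ε) {n : ℕ} (hn : 0 < n)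
    {m : ℕ} (hk : Cnd (dl C ε n) 1 n m) :
    |(∫ ω, tA X n (m + 2) ω) - (1 / n) * ∑ r ∈ Finset.range (m + 1),
      ∫ ω, tA X n r ω * tA X n (m - r) ω| ≤
      (m + 1) * ((2 / n + dl C ε n * n) * (2 * n * 8 ^ (2 * m))) := by
  obtain ⟨EA, SA, a1, a2, a3, a4, a5⟩ := setup hC hX n hn
  have hd := (dl_nonneg (ε := ε) hC n)
  obtain ⟨EY, y1, y2, y3⟩ := modelY n hn hd
  have h1 := mean_bound hd hn a1 y1 y2 a4 a5 m
  simp only [a2, ev_trp, map_mul] at h1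
  refine h1.trans ?_
  have hn' : (0:ℝ) < n := by positivity
  have hb : ∀ r ≤ m, EY (trp n (2 * r)) ≤ 2 * n * 8 ^ (2 * m) := by
    intro r hr
    refine (y3 1 one_pos r (hk.mono hd hr)).trans ?_
    norm_num
    gcongr
    norm_num
  have : ∑ r ∈ Finset.range (m + 1), (1 / (n:ℝ) + dl C ε n * n) *
        ((EY (trp n (2 * r)) + EY (trp n (2 * (m - r)))) / 2) ≤
      ∑ r ∈ Finset.range (m + 1), ((2 / n + dl C ε n * n) * (2 * n * 8 ^ (2 * m))) := by
    refine Finset.sum_le_sum fun r hr => ?_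
    have hr' := Finset.mem_range.mp hr
    have b1 := hb r (by omega)
    have b2 := hb (m - r) (by omega)
    have p1 := trp_nonneg hd y1 (2 * r)
    have p2 := trp_nonneg hd y1 (2 * (m - r))
    gcongr
    · norm_num
    · linarith
  refine this.trans (le_of_eq ?_)
  simp

end Wig

end PartI

section PartJ
namespace Wig

lemma log_seq (K L : ℕ) {γ : ℝ} (hγ : 0 < γ) :
    Tendsto (fun n : ℕ => ((K + L * Nat.log 2 n : ℕ) : ℝ) / (n:ℝ) ^ γ) atTop (𝓝 0) := by
  have h1 : Tendsto (fun n : ℕ => Real.log n / (n:ℝ) ^ γ) atTop (𝓝 0) :=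
    ((isLittleO_log_rpow_atTop hγ).tendsto_div_nhds_zero).comp tendsto_natCast_atTop_atTop
  have h2 : Tendsto (fun n : ℕ => (K:ℝ) / (n:ℝ) ^ γ) atTop (𝓝 0) :=
    ((tendsto_rpow_atTop hγ).comp tendsto_natCast_atTop_atTop).const_div_atTop _
  have h3 : Tendsto (fun n : ℕ => (K:ℝ) / (n:ℝ) ^ γ + (L / Real.log 2) * (Real.log n / (n:ℝ) ^ γ))
      atTop (𝓝 0) := by
    have := h2.add (h1.const_mul (L / Real.log 2))
    simpa using this
  refine squeeze_zero (fun n => by positivity) (fun n => ?_) h3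
  have hl : ((Nat.log 2 n : ℕ):ℝ) ≤ Real.log n / Real.log 2 := by
    have := Real.natLog_le_logb n 2
    simpa [Real.logb] using this
  have : ((K + L * Nat.log 2 n : ℕ) : ℝ) ≤ K + L * (Real.log n / Real.log 2) := by
    push_cast; gcongr
  calc _ ≤ (K + L * (Real.log n / Real.log 2)) / (n:ℝ) ^ γ := by gcongr
    _ = _ := by ring

lemma dl_mul {C ε : ℝ} {n : ℕ} (hn : 0 < n) : dl C ε n * n = C * (n:ℝ) ^ (-ε) := by
  have hn' : (0:ℝ) < n := by positivity
  rw [dl, mul_assoc]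
  congr 1
  nth_rewrite 2 [← Real.rpow_one (n:ℝ)]
  rw [← Real.rpow_add hn']
  congr 1; ring

lemma eventually_cnd {C ε η : ℝ} (hε : 0 < ε) (hη : 0 < η) (K L : ℕ) :
    ∀ᶠ n : ℕ in atTop, Cnd (dl C ε n) η n (K + L * Nat.log 2 n) := by
  have a1 := log_seq K L one_pos
  have a2 := log_seq K L (γ := 2 / 3) (by norm_num)
  have a3 := log_seq K L hε
  have t1 : Tendsto (fun n : ℕ => 1 + 2 * (((K + L * Nat.log 2 n : ℕ) : ℝ) / (n:ℝ) ^ (1:ℝ)) +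
      16 * (((K + L * Nat.log 2 n : ℕ) : ℝ) / (n:ℝ) ^ (2/3:ℝ)) ^ 3) atTop (𝓝 1) := by
    have := ((a1.const_mul 2).const_add 1).add ((a2.pow 3).const_mul 16)
    simpa using this
  have t2 : Tendsto (fun n : ℕ => (1 + 1 / η) ^ 2 * (C * 2 *
      (((K + L * Nat.log 2 n : ℕ) : ℝ) / (n:ℝ) ^ ε))) atTop (𝓝 0) := by
    have := (a3.const_mul (C * 2)).const_mul ((1 + 1 / η) ^ 2)
    simpa using this
  filter_upwards [t1.eventually_le_const (u := (1 + η) ^ 2) (by nlinarith),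
    t2.eventually_le_const (u := 1) one_pos, eventually_gt_atTop 0] with n h1 h2 hn
  have hn' : (0:ℝ) < n := by positivity
  constructor
  · refine le_trans (le_of_eq ?_) h1
    have e : ((n:ℝ) ^ (2/3:ℝ)) ^ 3 = n ^ 2 := by
      rw [← Real.rpow_natCast, ← Real.rpow_mul hn'.le, ← Real.rpow_natCast]; norm_num
    rw [div_pow, e, Real.rpow_one]
    push_cast
    ring
  · refine le_trans (le_of_eq ?_) h2
    rw [dl_mul hn, Real.rpow_neg hn'.le]
    ring

lemma as_zero {Ω : Type*} [MeasurableSpace Ω] {μ : Measure Ω} {Z : ℕ → Ω → ℝ} {s : ℕ → ℝ}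
    (h : ∀ᶠ n in atTop, (∀ ω, 0 ≤ Z n ω) ∧ Integrable (Z n) μ ∧ ∫ ω, Z n ω ∂μ ≤ s n)
    (hs : Summable s) : ∀ᵐ ω ∂μ, Tendsto (fun n => Z n ω) atTop (𝓝 0) := by
  obtain ⟨N, hN⟩ := eventually_atTop.mp h
  have hs' : Summable fun n => s (n + N) := (summable_nat_add_iff N).mpr hs
  have hn : ∀ n, N ≤ n + N := fun n => by omega
  have hs0 : ∀ n, 0 ≤ s (n + N) := fun n =>
    (integral_nonneg (hN _ (hn n)).1).trans (hN _ (hn n)).2.2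
  have hm : ∀ n, AEMeasurable (fun ω => ENNReal.ofReal (Z (n + N) ω)) μ := fun n =>
    (hN _ (hn n)).2.1.aestronglyMeasurable.aemeasurable.ennreal_ofReal
  have h1 : ∫⁻ ω, ∑' n, ENNReal.ofReal (Z (n + N) ω) ∂μ ≠ ⊤ := by
    rw [lintegral_tsum hm]
    have : ∀ n, ∫⁻ ω, ENNReal.ofReal (Z (n + N) ω) ∂μ ≤ ENNReal.ofReal (s (n + N)) := by
      intro n
      rw [← ofReal_integral_eq_lintegral_ofReal (hN _ (hn n)).2.1
        (ae_of_all _ (hN _ (hn n)).1)]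
      exact ENNReal.ofReal_le_ofReal (hN _ (hn n)).2.2
    refine ne_top_of_le_ne_top ?_ (ENNReal.tsum_le_tsum this)
    rw [← ENNReal.ofReal_tsum_of_nonneg hs0 hs']
    exact ENNReal.ofReal_ne_top
  have h2 := ae_lt_top' (AEMeasurable.ennreal_tsum hm) h1
  filter_upwards [h2] with ω hω
  have h3 := ENNReal.tendsto_atTop_zero_of_tsum_ne_top hω.ne
  have h4 := (ENNReal.tendsto_toReal ENNReal.zero_ne_top).comp h3
  rw [← tendsto_add_atTop_iff_nat N]
  refine h4.congr fun n => ?_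
  simp [ENNReal.toReal_ofReal ((hN _ (hn n)).1 ω)]

lemma cov_half {Ω : Type*} [MeasurableSpace Ω] {μ : Measure Ω} [IsProbabilityMeasure μ]
    {f g : Ω → ℝ} (hf : Integrable f μ) (hg : Integrable g μ)
    (hff : Integrable (fun ω => f ω * f ω) μ) (hgg : Integrable (fun ω => g ω * g ω) μ)
    (hfg : Integrable (fun ω => f ω * g ω) μ) :
    |(∫ ω, f ω * g ω ∂μ) - (∫ ω, f ω ∂μ) * ∫ ω, g ω ∂μ| ≤
      (((∫ ω, f ω * f ω ∂μ) - (∫ ω, f ω ∂μ) ^ 2) + ((∫ ω, g ω * g ω ∂μ) - (∫ ω, g ω ∂μ) ^ 2)) / 2 := by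
  set a := ∫ ω, f ω ∂μ with ha
  set b := ∫ ω, g ω ∂μ with hb
  have key : ∀ s : ℝ, 0 ≤ (∫ ω, f ω * f ω ∂μ) + s ^ 2 * (∫ ω, g ω * g ω ∂μ)
      + 2 * s * (∫ ω, f ω * g ω ∂μ) - (a + s * b) ^ 2 := by
    intro s
    have h0 : 0 ≤ ∫ ω, ((f ω + s * g ω) - (a + s * b)) ^ 2 ∂μ :=
      integral_nonneg fun ω => sq_nonneg _
    have e : ∀ ω, ((f ω + s * g ω) - (a + s * b)) ^ 2 = f ω * f ω + s ^ 2 * (g ω * g ω) +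
        2 * s * (f ω * g ω) - 2 * (a + s * b) * f ω - 2 * (a + s * b) * s * g ω + (a + s * b) ^ 2 := by
      intro ω; ring
    simp only [e] at h0
    have i1 := hff.add (hgg.const_mul (s ^ 2))
    have i2 := i1.add (hfg.const_mul (2 * s))
    have i3 := i2.sub (hf.const_mul (2 * (a + s * b)))
    have i4 := i3.sub (hg.const_mul (2 * (a + s * b) * s))
    rw [integral_add (by exact i4) (integrable_const _), integral_sub (by exact i3) (hg.const_mul _),
      integral_sub (by exact i2) (hf.const_mul _), integral_add (by exact i1) (hfg.const_mul _),
      integral_add hff (hgg.const_mul _)] at h0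
    simp only [integral_const_mul, integral_const, probReal_univ, one_smul] at h0
    rw [← ha, ← hb] at h0
    linarith
  have k1 := key 1
  have k2 := key (-1)
  rw [abs_le]
  constructor <;> nlinarith

end Wig

end PartJ

section PartK
namespace Wig

variable {Ω : Type*} [MeasureSpace Ω] [IsProbabilityMeasure (volume : Measure Ω)]
  {X : (n : ℕ) → Ω → Matrix (Fin n) (Fin n) ℝ} {C ε : ℝ}

lemma tA_even_nonneg (hX : CorrGaussian Ω X C ε) (n k : ℕ) (ω : Ω) : 0 ≤ tA X n (2 * k) ω := by
  obtain ⟨U, d, h⟩ := exists_diag (AA_symm hX n ω)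
  rw [tA, h.trace_pow]
  exact Finset.sum_nonneg fun i _ => by rw [pow_mul]; positivity

lemma upper (hC : 0 < C) (hε : 0 < ε) (hX : CorrGaussian Ω X C ε) {η : ℝ} (hη : 0 < η) :
    ∀ᵐ ω, ∀ᶠ n in atTop, ∀ U d, Diag (AA X n ω) U d → ∀ i, |d i| ≤ 2 * (1 + η) ^ 3 := by
  obtain ⟨L, hL⟩ := pow_unbounded_of_one_lt 8 (by linarith : 1 < 1 + η)
  have hL' : 8 ≤ (1 + η) ^ (2 * L) := by
    refine hL.le.trans (pow_le_pow_right₀ (by linarith) (by omega))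
  set R := 2 * (1 + η) ^ 3 with hR
  have hR0 : 0 < R := by positivity
  let k : ℕ → ℕ := fun n => 1 + L * Nat.log 2 n
  have hz := as_zero (μ := (volume : Measure Ω))
    (Z := fun n ω => (R ^ (2 * k n))⁻¹ * tA X n (2 * k n) ω) (s := fun n => 16 * (1 / (n:ℝ) ^ 2)) ?_
    ((Real.summable_one_div_nat_pow.mpr one_lt_two).mul_left 16)
  · filter_upwards [hz] with ω hω
    filter_upwards [hω.eventually_lt_const one_pos] with n hn U d h i
    have h1 : tA X n (2 * k n) ω < R ^ (2 * k n) := by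
      rwa [inv_mul_lt_iff₀ (by positivity), mul_one] at hn
    rw [tA, h.trace_pow] at h1
    have ev : Even (2 * k n) := even_two_mul _
    have h2 : d i ^ (2 * k n) ≤ ∑ j, d j ^ (2 * k n) :=
      Finset.single_le_sum (f := fun j => d j ^ (2 * k n)) (fun j _ => ev.pow_nonneg _)
        (Finset.mem_univ i)
    have h3 : |d i| ^ (2 * k n) ≤ R ^ (2 * k n) := by
      rw [ev.pow_abs]; exact h2.trans h1.le
    exact (pow_le_pow_iff_left₀ (abs_nonneg _) hR0.le (by simp [k])).mp h3
  · filter_upwards [eventually_cnd (C := C) hε hη 1 L, eventually_gt_atTop 0] with n hn hn0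
    have hn' : (0:ℝ) < n := by positivity
    refine ⟨fun ω => mul_nonneg (by positivity) (tA_even_nonneg hX _ _ _),
      (tA_int hC hX hn0 _).const_mul _, ?_⟩
    rw [integral_const_mul]
    have h1 := bound1 hC hX hn0 hη hn
    have h2 : (n:ℝ) ^ 3 ≤ 8 * (1 + η) ^ (2 * k n) := by
      have a1 : n ≤ 2 * 2 ^ Nat.log 2 n := by
        have := Nat.lt_pow_succ_log_self one_lt_two n
        rw [pow_succ] at this; omega
      have a2 : (n:ℝ) ≤ 2 * 2 ^ Nat.log 2 n := by exact_mod_cast a1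
      calc (n:ℝ) ^ 3 ≤ (2 * 2 ^ Nat.log 2 n) ^ 3 := by gcongr
        _ = 8 * 8 ^ Nat.log 2 n := by
          rw [mul_pow, ← pow_mul, mul_comm (Nat.log 2 n) 3, pow_mul]; norm_num
        _ ≤ 8 * ((1 + η) ^ (2 * L)) ^ Nat.log 2 n := by gcongr
        _ ≤ _ := by
          rw [← pow_mul]
          refine mul_le_mul_of_nonneg_left (pow_le_pow_right₀ (by linarith) ?_) (by norm_num)
          change 2 * L * Nat.log 2 n ≤ 2 * (1 + L * Nat.log 2 n)
          rw [mul_assoc]; omega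
    rw [inv_mul_le_iff₀ (by positivity)]
    refine h1.trans ?_
    have e : R ^ (2 * k n) = (2 * (1 + η) ^ 2) ^ (2 * k n) * (1 + η) ^ (2 * k n) := by
      rw [← mul_pow, hR]; congr 1; ring
    change 2 * n * (2 * (1 + η) ^ 2) ^ (2 * k n) ≤ _
    rw [e, mul_assoc ((2 * (1 + η) ^ 2) ^ (2 * k n)), mul_comm (2 * (n:ℝ))]
    refine mul_le_mul_of_nonneg_left ?_ (by positivity)
    rw [show (1 + η) ^ (2 * k n) * (16 * (1 / (n:ℝ) ^ 2)) = 2 * (8 * (1 + η) ^ (2 * k n)) / n ^ 2 by ring,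
      le_div_iff₀ (by positivity)]
    nlinarith [h2]

/-- error parameter -/
noncomputable def kap (C ε : ℝ) (n : ℕ) : ℝ := 2 / n + dl C ε n * n

lemma kap_tendsto (hε : 0 < ε) : Tendsto (kap C ε) atTop (𝓝 0) := by
  have h1 : Tendsto (fun n : ℕ => (2:ℝ) / n) atTop (𝓝 0) :=
    tendsto_const_div_atTop_nhds_zero_nat 2
  have h2 : Tendsto (fun n : ℕ => C * (n:ℝ) ^ (-ε)) atTop (𝓝 0) := by
    have := ((tendsto_rpow_neg_atTop hε).comp tendsto_natCast_atTop_atTop).const_mul C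
    simpa using this
  have h3 := h1.add h2
  rw [add_zero] at h3
  refine h3.congr' ?_
  filter_upwards [eventually_gt_atTop 0] with n hn
  rw [kap, dl_mul hn]

lemma kap_summable (hε : 0 < ε) : Summable fun n => kap C ε n / n := by
  have h1 : Summable fun n : ℕ => 2 * (1 / (n:ℝ) ^ 2) :=
    (Real.summable_one_div_nat_pow.mpr one_lt_two).mul_left 2
  have h2 : Summable fun n : ℕ => C * (n:ℝ) ^ (-(1 + ε)) :=
    (Real.summable_nat_rpow.mpr (by linarith)).mul_left C
  refine (h1.add h2).congr fun n => ?_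
  rcases Nat.eq_zero_or_pos n with rfl | hn
  · simp [Real.zero_rpow (by linarith : -(1 + ε) ≠ 0), Real.zero_rpow (by linarith : -1 - ε ≠ 0)]
    right; exact Real.zero_rpow (by linarith)
  · have hn' : (n:ℝ) ≠ 0 := by positivity
    rw [kap, dl]
    field_simp

/-- normalised moments -/
noncomputable def mm (X : (n : ℕ) → Ω → Matrix (Fin n) (Fin n) ℝ) (n k : ℕ) (ω : Ω) : ℝ :=
  tA X n k ω / n

lemma mm_int (hC : 0 < C) (hX : CorrGaussian Ω X C ε) {n : ℕ} (hn : 0 < n) (k : ℕ) :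
    Integrable (mm X n k) := (tA_int hC hX hn k).div_const _

lemma mm_mul_int (hC : 0 < C) (hX : CorrGaussian Ω X C ε) {n : ℕ} (hn : 0 < n) (k l : ℕ) :
    Integrable (fun ω => mm X n k ω * mm X n l ω) := by
  have := (tA_mul_int hC hX hn k l).div_const ((n:ℝ) * n)
  refine this.congr (ae_of_all _ fun ω => ?_)
  simp only [mm]; rw [div_mul_div_comm]

lemma mm_var (hC : 0 < C) (hε : 0 < ε) (hX : CorrGaussian Ω X C ε) (k : ℕ) :
    ∃ K : ℝ, ∀ᶠ n in atTop, (∫ ω, mm X n k ω * mm X n k ω) - (∫ ω, mm X n k ω) ^ 2 ≤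
      K * (kap C ε n / n) := by
  refine ⟨(k:ℝ) ^ 2 * (2 * 8 ^ (2 * k)), ?_⟩
  filter_upwards [eventually_cnd (C := C) hε one_pos k 0, eventually_gt_atTop 0] with n hc hn
  have hn' : (0:ℝ) < n := by positivity
  simp only [zero_mul, add_zero] at hc
  have h := bound2 hC hX hn hc
  simp only [mm, div_mul_div_comm, integral_div]
  rw [div_pow, ← sq (n:ℝ), ← sub_div, div_le_iff₀ (by positivity)]
  refine h.trans (le_of_eq ?_)
  rw [kap]; field_simp

lemma mm_mean (hC : 0 < C) (hε : 0 < ε) (hX : CorrGaussian Ω X C ε) (m : ℕ) :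
    ∃ K : ℝ, ∀ᶠ n in atTop, |(∫ ω, mm X n (m + 2) ω) - ∑ r ∈ Finset.range (m + 1),
      ∫ ω, mm X n r ω * mm X n (m - r) ω| ≤ K * kap C ε n := by
  refine ⟨(m + 1) * (2 * 8 ^ (2 * m)), ?_⟩
  filter_upwards [eventually_cnd (C := C) hε one_pos m 0, eventually_gt_atTop 0] with n hc hn
  have hn' : (0:ℝ) < n := by positivity
  simp only [zero_mul, add_zero] at hc
  have h := bound3 hC hX hn hc
  simp only [mm, div_mul_div_comm, integral_div]
  rw [← Finset.sum_div]
  have e : (∫ ω, tA X n (m + 2) ω) / n - (∑ r ∈ Finset.range (m + 1),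
      ∫ ω, tA X n r ω * tA X n (m - r) ω) / (n * n) = ((∫ ω, tA X n (m + 2) ω) -
      1 / n * ∑ r ∈ Finset.range (m + 1), ∫ ω, tA X n r ω * tA X n (m - r) ω) / n := by
    field_simp
  rw [e, abs_div, abs_of_pos hn', div_le_iff₀ hn']
  refine h.trans (le_of_eq ?_)
  rw [kap]; ring

lemma u_tendsto (hC : 0 < C) (hε : 0 < ε) (hX : CorrGaussian Ω X C ε) (k : ℕ) :
    Tendsto (fun n => ∫ ω, mm X n k ω) atTop (𝓝 (cs k)) := by
  induction k using Nat.strong_induction_on with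
  | _ k ih =>
    match k with
    | 0 =>
      rw [cs_zero]
      refine tendsto_const_nhds.congr' ?_
      filter_upwards [eventually_gt_atTop 0] with n hn
      have hn' : (n:ℝ) ≠ 0 := by positivity
      simp [mm, tA, hn']
    | 1 =>
      rw [cs_one]
      refine tendsto_const_nhds.congr' ?_
      filter_upwards [eventually_gt_atTop 0] with n hn
      obtain ⟨EA, SA, a1, a2, a3, a4, a5⟩ := setup hC hX n hn
      have := a1.trp_succ 0
      rw [a2] at this
      simp only [ev_trp, zero_add, Finset.range_zero, Finset.sum_empty] at this
      simp only [mm, integral_div, tA, this, zero_div]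
    | m + 2 =>
      have hv : ∀ k, Tendsto (fun n => (∫ ω, mm X n k ω * mm X n k ω) - (∫ ω, mm X n k ω) ^ 2)
          atTop (𝓝 0) := by
        intro k
        obtain ⟨K, hK⟩ := mm_var hC hε hX k
        refine squeeze_zero' ?_ hK ?_
        · filter_upwards [eventually_gt_atTop 0] with n hn
          have i1 := mm_int hC hX hn k
          have i2 := mm_mul_int hC hX hn k k
          have := (abs_nonneg _).trans (cov_half i1 i1 i2 i2 i2)
          linarith
        · have := (kap_summable (C := C) hε).tendsto_atTop_zero.const_mul K
          simpa using this
      have hprod : ∀ r s, r < m + 2 → s < m + 2 →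
          Tendsto (fun n => ∫ ω, mm X n r ω * mm X n s ω) atTop (𝓝 (cs r * cs s)) := by
        intro r s hr hs
        have h1 := (ih r hr).mul (ih s hs)
        have h2 : Tendsto (fun n => (∫ ω, mm X n r ω * mm X n s ω) -
            (∫ ω, mm X n r ω) * ∫ ω, mm X n s ω) atTop (𝓝 0) := by
          refine squeeze_zero_norm' ?_ (by simpa using ((hv r).add (hv s)).div_const 2)
          filter_upwards [eventually_gt_atTop 0] with n hn
          rw [Real.norm_eq_abs]
          exact cov_half (mm_int hC hX hn r) (mm_int hC hX hn s) (mm_mul_int hC hX hn r r)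
            (mm_mul_int hC hX hn s s) (mm_mul_int hC hX hn r s)
        have h3 := h2.add h1
        simpa using h3
      have hsum : Tendsto (fun n => ∑ r ∈ Finset.range (m + 1),
          ∫ ω, mm X n r ω * mm X n (m - r) ω) atTop (𝓝 (cs (m + 2))) := by
        rw [cs_add_two]
        refine tendsto_finsetSum _ fun r hr => ?_
        have := Finset.mem_range.mp hr
        exact hprod _ _ (by omega) (by omega)
      obtain ⟨K, hK⟩ := mm_mean hC hε hX m
      have hd : Tendsto (fun n => (∫ ω, mm X n (m + 2) ω) - ∑ r ∈ Finset.range (m + 1),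
          ∫ ω, mm X n r ω * mm X n (m - r) ω) atTop (𝓝 0) := by
        refine squeeze_zero_norm' hK ?_
        have := (kap_tendsto (C := C) hε).const_mul K
        simpa using this
      have := hd.add hsum
      simpa using this

lemma mm_as (hC : 0 < C) (hε : 0 < ε) (hX : CorrGaussian Ω X C ε) (k : ℕ) :
    ∀ᵐ ω, Tendsto (fun n => mm X n k ω) atTop (𝓝 (cs k)) := by
  obtain ⟨K, hK⟩ := mm_var hC hε hX k
  have hz := as_zero (μ := (volume : Measure Ω))
    (Z := fun n ω => (mm X n k ω - ∫ ω, mm X n k ω) ^ 2) (s := fun n => K * (kap C ε n / n)) ?_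
    ((kap_summable hε).mul_left K)
  · filter_upwards [hz] with ω hω
    have h1 : Tendsto (fun n => mm X n k ω - ∫ ω, mm X n k ω) atTop (𝓝 0) := by
      have := hω.sqrt
      simp only [Real.sqrt_sq_eq_abs, Real.sqrt_zero] at this
      exact (tendsto_zero_iff_abs_tendsto_zero _).mpr this
    have := h1.add (u_tendsto hC hε hX k)
    simpa using this
  · filter_upwards [hK, eventually_gt_atTop 0] with n h hn
    have i1 := mm_int hC hX hn k
    have i2 := mm_mul_int hC hX hn k k
    set u := ∫ ω, mm X n k ω with hu
    have e : ∀ ω, (mm X n k ω - u) ^ 2 = mm X n k ω * mm X n k ω - 2 * u * mm X n k ω + u ^ 2 := by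
      intro ω; ring
    have i3 := i2.sub (i1.const_mul (2 * u))
    refine ⟨fun ω => sq_nonneg _, ?_, ?_⟩
    · simp only [e]
      exact Integrable.add i3 (integrable_const _)
    · simp only [e]
      rw [integral_add (by exact i3) (integrable_const _), integral_sub i2 (i1.const_mul _),
        integral_const_mul, ← hu]
      simp only [integral_const, probReal_univ, one_smul]
      linarith

end Wig

end PartK

section PartL
namespace Wig

variable {Ω : Type*} [MeasureSpace Ω] [IsProbabilityMeasure (volume : Measure Ω)]
  {X : (n : ℕ) → Ω → Matrix (Fin n) (Fin n) ℝ} {C ε : ℝ}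

lemma cs_lower {m j : ℕ} (hj : j ≤ m) :
    (2:ℝ) ^ j * (1 + (-1) ^ j) ≤ 4 * (m + 1) ^ 2 * cs j := by
  obtain ⟨i, rfl | rfl⟩ := j.even_or_odd'
  · have h := cs_ge i
    have h0 := cs_nonneg (2 * i)
    have hi : (i:ℝ) ≤ m := by exact_mod_cast (by omega : i ≤ m)
    have h2 : ((i:ℝ) + 1) ^ 2 * cs (2 * i) ≤ ((m:ℝ) + 1) ^ 2 * cs (2 * i) := by gcongr
    rw [pow_mul, pow_mul]
    norm_num
    linarith
  · have h0 := cs_nonneg (2 * i + 1)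
    rw [pow_succ (-1 : ℝ), pow_mul]
    norm_num
    positivity

lemma S_lower {b : ℝ} (hb : 2 ≤ b) (m : ℕ) :
    (4:ℝ) ^ m ≤ 4 * (m + 1) ^ 2 *
      ∑ j ∈ Finset.range (m + 1), cs j * b ^ (m - j) * (m.choose j : ℝ) := by
  have e1 := add_pow (1:ℝ) 1 m
  have e2 := add_pow (-1:ℝ) 1 m
  have h0 : (0:ℝ) ≤ (-1 + 1) ^ m := by norm_num
  have key : (4:ℝ) ^ m ≤ 2 ^ m * ((1 + 1) ^ m + (-1 + 1) ^ m) := by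
    have : (4:ℝ) ^ m = 2 ^ m * (1 + 1) ^ m := by rw [← mul_pow]; norm_num
    rw [this]; gcongr; linarith
  refine key.trans ?_
  rw [e1, e2, ← Finset.sum_add_distrib, Finset.mul_sum, Finset.mul_sum]
  refine Finset.sum_le_sum fun j hj => ?_
  have hj : j ≤ m := by simpa [Nat.lt_succ_iff] using hj
  have h1 := cs_lower hj
  have h2 := cs_nonneg j
  have h3 : (2:ℝ) ^ m = 2 ^ (m - j) * 2 ^ j := by rw [← pow_add]; congr 1; omega
  have h4 : (2:ℝ) ^ (m - j) ≤ b ^ (m - j) := by gcongr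
  calc (2:ℝ) ^ m * (1 ^ j * 1 ^ (m - j) * (m.choose j : ℝ) + (-1) ^ j * 1 ^ (m - j) * (m.choose j : ℝ))
      = 2 ^ (m - j) * (2 ^ j * (1 + (-1) ^ j)) * (m.choose j : ℝ) := by
        rw [h3]; simp only [one_pow]; ring
    _ ≤ 2 ^ (m - j) * (4 * (m + 1) ^ 2 * cs j) * (m.choose j : ℝ) := by
        refine mul_le_mul_of_nonneg_right (mul_le_mul_of_nonneg_left h1 (by positivity)) (by positivity)
    _ ≤ b ^ (m - j) * (4 * (m + 1) ^ 2 * cs j) * (m.choose j : ℝ) := by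
        refine mul_le_mul_of_nonneg_right (mul_le_mul_of_nonneg_right h4 (by positivity)) (by positivity)
    _ = _ := by ring

lemma exists_m {c : ℝ} (hc : 0 < c) (hc' : c < 4) :
    ∃ m : ℕ, 4 * ((m:ℝ) + 1) ^ 2 * (4 - c / 2) ^ m < 4 ^ m := by
  set r : ℝ := (4 - c / 2) / 4 with hr
  have r0 : 0 < r := by rw [hr]; linarith
  have r1 : r < 1 := by rw [hr]; linarith
  have h := (tendsto_pow_const_mul_const_pow_of_abs_lt_one 2
    (by rwa [abs_of_pos r0] : |r| < 1)).comp (tendsto_add_atTop_nat 1)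
  obtain ⟨m, hm⟩ := (h.eventually_lt_const (by positivity : 0 < r / 4)).exists
  refine ⟨m, ?_⟩
  simp only [Function.comp, pow_succ r] at hm
  push_cast at hm
  have e : (4 - c / 2) = 4 * r := by rw [hr]; ring
  have h2 : 4 * ((m:ℝ) + 1) ^ 2 * r ^ m < 1 := by
    by_contra hh
    push Not at hh
    nlinarith
  rw [e, mul_pow]
  have : (0:ℝ) < 4 ^ m := by positivity
  nlinarith

lemma lower {ω : Ω} (hX : CorrGaussian Ω X C ε)
    (hmm : ∀ k, Tendsto (fun n => mm X n k ω) atTop (𝓝 (cs k))) {b c : ℝ}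
    (hc : 0 < c) (hc' : c < 4) (hb : 2 ≤ b) (hbc : b ≤ 2 + c / 2)
    (hup : ∀ᶠ n in atTop, ∀ U d, Diag (AA X n ω) U d → ∀ i, |d i| ≤ b) :
    ∀ᶠ n in atTop, ∀ U d, Diag (AA X n ω) U d → ∃ i, 2 - c ≤ d i := by
  obtain ⟨m, hm⟩ := exists_m hc hc'
  have hS := S_lower hb m
  have hlt : (4 - c / 2) ^ m <
      ∑ j ∈ Finset.range (m + 1), cs j * b ^ (m - j) * (m.choose j : ℝ) := by
    refine lt_of_mul_lt_mul_left (hm.trans_le hS) (by positivity)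
  have ht : Tendsto (fun n => ∑ j ∈ Finset.range (m + 1),
      mm X n j ω * b ^ (m - j) * (m.choose j : ℝ)) atTop
      (𝓝 (∑ j ∈ Finset.range (m + 1), cs j * b ^ (m - j) * (m.choose j : ℝ))) :=
    tendsto_finset_sum _ fun j _ => ((hmm j).mul_const _).mul_const _
  filter_upwards [ht.eventually_const_lt hlt, hup, eventually_gt_atTop 0] with n h1 h2 hn U d h
  by_contra hh
  push Not at hh
  have hn' : (0:ℝ) < n := by positivity
  have e : ∑ j ∈ Finset.range (m + 1), mm X n j ω * b ^ (m - j) * (m.choose j : ℝ)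
      = (∑ i, (d i + b) ^ m) / n := by
    simp only [add_pow]
    rw [Finset.sum_comm, Finset.sum_div]
    refine Finset.sum_congr rfl fun j _ => ?_
    rw [mm, tA, h.trace_pow, ← Finset.sum_mul, ← Finset.sum_mul]
    ring
  rw [e, lt_div_iff₀ hn'] at h1
  have : ∑ i, (d i + b) ^ m ≤ ∑ _i : Fin n, (4 - c / 2) ^ m := by
    refine Finset.sum_le_sum fun i _ => ?_
    have a := abs_le.mp (h2 U d h i)
    have a' := hh i
    exact pow_le_pow_left₀ (by linarith) (by linarith) m
  rw [Finset.sum_const, Finset.card_univ, Fintype.card_fin, nsmul_eq_mul] at this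
  linarith

theorem main (hC : 0 < C) (hε : 0 < ε) (hX : CorrGaussian Ω X C ε) :
    ∀ᵐ ω ∂(volume : Measure Ω),
      Tendsto (fun n : ℕ => lam1 (AA X n ω)) atTop (𝓝 2) := by
  have hU : ∀ᵐ ω ∂(volume : Measure Ω), ∀ j : ℕ, ∀ᶠ n in atTop, ∀ U d, Diag (AA X n ω) U d →
      ∀ i, |d i| ≤ 2 * (1 + 1 / ((j:ℝ) + 1)) ^ 3 :=
    ae_all_iff.mpr fun j => upper hC hε hX (by positivity)
  have hM : ∀ᵐ ω ∂(volume : Measure Ω), ∀ k, Tendsto (fun n => mm X n k ω) atTop (𝓝 (cs k)) :=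
    ae_all_iff.mpr fun k => mm_as hC hε hX k
  have hlim : Tendsto (fun j : ℕ => 2 * (1 + 1 / ((j:ℝ) + 1)) ^ 3) atTop (𝓝 2) := by
    have := (((tendsto_one_div_add_atTop_nhds_zero_nat (𝕜 := ℝ)).const_add 1).pow 3).const_mul 2
    simpa using this
  have hge (j : ℕ) : (2:ℝ) ≤ 2 * (1 + 1 / ((j:ℝ) + 1)) ^ 3 := by
    have : (1:ℝ) ≤ (1 + 1 / ((j:ℝ) + 1)) ^ 3 :=
      one_le_pow₀ (by have : (0:ℝ) ≤ 1 / ((j:ℝ) + 1) := by positivity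
                      linarith)
    linarith
  filter_upwards [hU, hM] with ω hu hm
  rw [tendsto_order]
  constructor
  · intro a ha
    set c := min ((2 - a) / 2) 1 with hcdef
    have hc : 0 < c := lt_min (by linarith) one_pos
    have hc1 : c ≤ 1 := min_le_right _ _
    have hc2 : c ≤ (2 - a) / 2 := min_le_left _ _
    obtain ⟨j, hj⟩ := (hlim.eventually_lt_const (by linarith : (2:ℝ) < 2 + c / 2)).exists
    filter_upwards [lower hX hm hc (by linarith) (hge j) hj.le (hu j)] with n hn
    obtain ⟨U, d, h⟩ := exists_diag (AA_symm hX n ω)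
    obtain ⟨i, hi⟩ := hn U d h
    have : d i ≤ lam1 (AA X n ω) := by
      rw [lam1, h.eigen]
      exact le_csSup (Set.finite_range d).bddAbove ⟨i, rfl⟩
    linarith
  · intro a ha
    obtain ⟨j, hj⟩ := (hlim.eventually_lt_const ha).exists
    filter_upwards [hu j, eventually_gt_atTop 0] with n hn hn0
    obtain ⟨U, d, h⟩ := exists_diag (AA_symm hX n ω)
    refine lt_of_le_of_lt ?_ hj
    rw [lam1, h.eigen]
    refine csSup_le ⟨d ⟨0, hn0⟩, ⟨_, rfl⟩⟩ ?_
    rintro _ ⟨i, rfl⟩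
    exact (le_abs_self _).trans (hn U d h i)

end Wig

end PartL

/-- In the correlated Gaussian model with parameter `ε > 0`, the largest
eigenvalue of `n^{-1/2} X_n` converges to `2` almost surely. -/
theorem largest_eigenvalue_tendsto_two
    {Ω : Type*} [MeasureSpace Ω] [IsProbabilityMeasure (volume : Measure Ω)]
    (X : (n : ℕ) → Ω → Matrix (Fin n) (Fin n) ℝ) (C ε : ℝ)
    (hC : 0 < C) (hε : 0 < ε) (hX : CorrGaussian Ω X C ε) :
    ∀ᵐ ω ∂(volume : Measure Ω),
      Tendsto (fun n : ℕ => lam1 (((n : ℝ) ^ (-(1 / 2) : ℝ)) • X n ω)) atTop (𝓝 2) := by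
  exact Wig.main hC hε hX
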